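/- Let α > 0 be a real number. For n > 1 let p(n) denote the smallest prime divisor of n, P(n) the largest prime divisor of n, ω(n) the number of distinct prime divisors of n, and μ the Möbius function. Then as x → ∞, Σ_{1 < n ≤ x, μ(n) ≠ 0, ω(n) = 2} (p(n)/P(n))^α = (2/α)·x/(log x)^2 + (4/α)·x/(log x)^3 + O(x/(log x)^4). Equivalently, Σ_{p₁ < p₂ primes, p₁p₂ ≤ x} (p₁/p₂)^α has this asymptotic expansion. -/

import Mathlib

/-- The entire function `(s - 1) ζ(s)`. -/
noncomputable def zetaMulSubOne : ℂ → ℂ :=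
  Function.update (fun s : ℂ => (s - 1) * riemannZeta s) 1 1

lemma zetaMulSubOne_of_ne {s : ℂ} (hs : s ≠ 1) :
    zetaMulSubOne s = (s - 1) * riemannZeta s := by
  simp [zetaMulSubOne, Function.update_of_ne hs]

lemma zetaMulSubOne_one : zetaMulSubOne 1 = 1 := by
  simp [zetaMulSubOne]

lemma differentiable_zetaMulSubOne : Differentiable ℂ zetaMulSubOne := by
  have hc : ContinuousAt zetaMulSubOne 1 := by
    rw [zetaMulSubOne, continuousAt_update_same]
    exact riemannZeta_residue_one
  have hd : ∀ s : ℂ, s ≠ 1 → DifferentiableAt ℂ zetaMulSubOne s := by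
    intro s hs
    refine DifferentiableAt.congr_of_eventuallyEq
      (((differentiableAt_id).sub_const 1).mul (differentiableAt_riemannZeta hs)) ?_
    filter_upwards [isOpen_ne.mem_nhds hs] with z hz
    exact zetaMulSubOne_of_ne hz
  intro s
  rcases eq_or_ne s 1 with rfl | hs
  · refine (Complex.differentiableOn_compl_singleton_and_continuousAt_iff
      (s := Set.univ) Filter.univ_mem).mp ⟨?_, hc⟩ |>.differentiableAt Filter.univ_mem
    intro z hz
    exact (hd z (by simpa using hz)).differentiableWithinAt
  · exact hd s hs

lemma zetaMulSubOne_ne_zero {s : ℂ} (hs : 1 ≤ s.re) : zetaMulSubOne s ≠ 0 := by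
  rcases eq_or_ne s 1 with rfl | h
  · simp [zetaMulSubOne_one]
  · rw [zetaMulSubOne_of_ne h]
    exact mul_ne_zero (sub_ne_zero.mpr h) (riemannZeta_ne_zero_of_one_le_re hs)

/-- The terms of the Euler–Maclaurin expansion of `(s - 1) ζ(s)`. -/
noncomputable def zetaRemainder (n : ℕ) (s : ℂ) : ℂ :=
  (s - 1) * ((n + 1 : ℕ) : ℂ) ^ (-s) + ((n + 1 : ℕ) : ℂ) ^ (1 - s) - (n : ℂ) ^ (1 - s)

lemma differentiable_zetaRemainder {n : ℕ} (hn : n ≠ 0) : Differentiable ℂ (zetaRemainder n) := by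
  unfold zetaRemainder
  have h1 : ((n + 1 : ℕ) : ℂ) ≠ 0 := by exact_mod_cast n.succ_ne_zero
  have h2 : (n : ℂ) ≠ 0 := by exact_mod_cast hn
  intro s
  refine ((DifferentiableAt.mul (by fun_prop) (DifferentiableAt.const_cpow (by fun_prop)
    (Or.inl h1))).add (DifferentiableAt.const_cpow (by fun_prop) (Or.inl h1))).sub
    (DifferentiableAt.const_cpow (by fun_prop) (Or.inl h2))

lemma norm_cpow_neg_sub_cpow_neg_le {a u v : ℝ} (ha : 0 < a) (hu : a ≤ u) (hv : a ≤ v)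
    {s : ℂ} (hs : 0 ≤ s.re) :
    ‖(v : ℂ) ^ (-s) - (u : ℂ) ^ (-s)‖ ≤ ‖s‖ * a ^ (-s.re - 1) * |v - u| := by
  have := Convex.norm_image_sub_le_of_norm_hasDerivWithin_le (s := Set.Ici a)
    (f := fun x : ℝ => (x : ℂ) ^ (-s)) (f' := fun x : ℝ => -s * (x : ℂ) ^ (-s - 1))
    (C := ‖s‖ * a ^ (-s.re - 1)) (x := u) (y := v) ?_ ?_ (convex_Ici a) hu hv
  · simpa using this
  · intro x hx
    rcases eq_or_ne s 0 with rfl | h0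
    · simpa using hasDerivWithinAt_const x (Set.Ici a) (1 : ℂ)
    · exact (hasDerivAt_ofReal_cpow_const (ha.trans_le hx).ne'
        (neg_ne_zero.mpr h0)).hasDerivWithinAt
  · intro x hx
    have hx0 := ha.trans_le hx
    rw [norm_mul, norm_neg, Complex.norm_cpow_eq_rpow_re_of_pos hx0]
    refine mul_le_mul_of_nonneg_left ?_ (norm_nonneg _)
    simp only [Complex.sub_re, Complex.neg_re, Complex.one_re]
    exact Real.rpow_le_rpow_of_nonpos ha hx (by linarith)

lemma norm_zetaRemainder_le {n : ℕ} (hn : n ≠ 0) {s : ℂ} (hs : 0 ≤ s.re) :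
    ‖zetaRemainder n s‖ ≤ ‖s - 1‖ * ‖s‖ * (n : ℝ) ^ (-s.re - 1) := by
  have hn0 : (0 : ℝ) < n := by exact_mod_cast Nat.pos_of_ne_zero hn
  rcases eq_or_ne s 1 with rfl | h1
  · simp [zetaRemainder]
  have hne : (1 - s) ≠ 0 := sub_ne_zero.mpr h1.symm
  have := Convex.norm_image_sub_le_of_norm_hasDerivWithin_le (s := Set.Icc (n : ℝ) (n + 1))
    (f := fun x : ℝ => (s - 1) * ((n + 1 : ℕ) : ℂ) ^ (-s) * (x : ℂ) + (x : ℂ) ^ (1 - s))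
    (f' := fun x : ℝ => (s - 1) * ((n + 1 : ℕ) : ℂ) ^ (-s) * 1 + (1 - s) * (x : ℂ) ^ (1 - s - 1))
    (C := ‖s - 1‖ * ‖s‖ * (n : ℝ) ^ (-s.re - 1)) (x := n) (y := n + 1) ?_ ?_ (convex_Icc _ _)
    (by simp) (by simp)
  · have e : zetaRemainder n s = ((s - 1) * ((n + 1 : ℕ) : ℂ) ^ (-s) * ((n + 1 : ℝ) : ℂ)
      + ((n + 1 : ℝ) : ℂ) ^ (1 - s)) - ((s - 1) * ((n + 1 : ℕ) : ℂ) ^ (-s) * ((n : ℝ) : ℂ)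
      + ((n : ℝ) : ℂ) ^ (1 - s)) := by
      rw [zetaRemainder]; push_cast; ring
    rw [e]
    simpa using this
  · intro x hx
    have hx0 : 0 < x := hn0.trans_le hx.1
    exact ((Complex.ofRealCLM.hasDerivAt.const_mul _).add
      (hasDerivAt_ofReal_cpow_const hx0.ne' hne)).hasDerivWithinAt
  · intro x hx
    have h := norm_cpow_neg_sub_cpow_neg_le hn0 hx.1 (v := n + 1) (by simp) hs
    have e : (s - 1) * ((n + 1 : ℕ) : ℂ) ^ (-s) * 1 + (1 - s) * (x : ℂ) ^ (1 - s - 1)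
      = (s - 1) * (((n + 1 : ℝ) : ℂ) ^ (-s) - (x : ℂ) ^ (-s)) := by
      push_cast
      rw [show 1 - s - 1 = -s by ring]; ring
    rw [e, norm_mul, mul_assoc]
    refine mul_le_mul_of_nonneg_left (h.trans ?_) (norm_nonneg _)
    have : |(n : ℝ) + 1 - x| ≤ 1 := by
      rw [abs_le]; constructor <;> linarith [hx.1, hx.2]
    exact mul_le_of_le_one_right (by positivity) this

lemma mul_rpow_neg_sub_one_le {σ : ℝ} {n : ℕ} (hn : n ≠ 0) (hσ : 0 ≤ σ) :
    σ * ((n + 1 : ℕ) : ℝ) ^ (-σ - 1) ≤ (n : ℝ) ^ (-σ) - ((n + 1 : ℕ) : ℝ) ^ (-σ) := by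
  have hn0 : (0 : ℝ) < n := by exact_mod_cast Nat.pos_of_ne_zero hn
  have hm0 : (0 : ℝ) < ((n + 1 : ℕ) : ℝ) := by positivity
  set m : ℝ := ((n + 1 : ℕ) : ℝ) with hm
  have hmn : m = n + 1 := by simp [hm]
  have h1 : 1 + σ / m ≤ (m / n) ^ σ := by
    rw [Real.rpow_def_of_pos (by positivity)]
    have h2 : 1 - (m / n)⁻¹ ≤ Real.log (m / n) := Real.one_sub_inv_le_log_of_pos (by positivity)
    have h3 : 1 - (m / n)⁻¹ = 1 / m := by
      rw [hmn]; field_simp; ring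
    have h4 := Real.add_one_le_exp (Real.log (m / n) * σ)
    have h5 : σ / m ≤ Real.log (m / n) * σ := by
      rw [h3] at h2
      calc σ / m = 1 / m * σ := by ring
        _ ≤ _ := mul_le_mul_of_nonneg_right h2 hσ
    linarith
  have h6 : (n : ℝ) ^ (-σ) = (m / n) ^ σ * m ^ (-σ) := by
    rw [Real.div_rpow hm0.le hn0.le, Real.rpow_neg hn0.le, Real.rpow_neg hm0.le]
    field_simp
  rw [Real.rpow_sub_one hm0.ne', h6]
  have := mul_le_mul_of_nonneg_right h1 (Real.rpow_nonneg hm0.le (-σ))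
  calc σ * (m ^ (-σ) / m) = (1 + σ / m) * m ^ (-σ) - m ^ (-σ) := by ring
    _ ≤ _ := by linarith

lemma summable_norm_zetaRemainder {N : ℕ} (hN : N ≠ 0) {s : ℂ} (hs : 0 < s.re) :
    Summable fun n : ℕ => ‖zetaRemainder (n + N) s‖ := by
  refine Summable.of_nonneg_of_le (fun _ => norm_nonneg _)
    (fun n => norm_zetaRemainder_le (by omega) hs.le) ?_
  refine Summable.mul_left _ ?_
  exact (summable_nat_add_iff (f := fun n : ℕ => (n : ℝ) ^ (-s.re - 1)) N).mpr
    (Real.summable_nat_rpow.mpr (by linarith))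

lemma differentiableOn_tsum_zetaRemainder :
    DifferentiableOn ℂ (fun s => ∑' n : ℕ, zetaRemainder (n + 1) s) {s | 0 < s.re} := by
  intro s₀ hs₀
  have hs₀' : 0 < s₀.re := hs₀
  set U : Set ℂ := {s | s₀.re / 2 < s.re} ∩ Metric.ball 0 (‖s₀‖ + 1) with hU
  have hUo : IsOpen U := (isOpen_lt continuous_const Complex.continuous_re).inter Metric.isOpen_ball
  have hmem : s₀ ∈ U := ⟨by simp only [Set.mem_ofPred_eq]; linarith, by simp⟩
  have := Complex.differentiableOn_tsum_of_summable_norm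
    (F := fun (n : ℕ) s => zetaRemainder (n + 1) s) (U := U)
    (u := fun n : ℕ => ((‖s₀‖ + 2) * (‖s₀‖ + 1)) * ((n + 1 : ℕ) : ℝ) ^ (-(s₀.re / 2) - 1)) ?_
    (fun n => (differentiable_zetaRemainder n.succ_ne_zero).differentiableOn) hUo ?_
  · exact (this.differentiableAt (hUo.mem_nhds hmem)).differentiableWithinAt
  · refine Summable.mul_left _ ?_
    exact (summable_nat_add_iff (f := fun n : ℕ => (n : ℝ) ^ (-(s₀.re / 2) - 1)) 1).mpr
      (Real.summable_nat_rpow.mpr (by linarith))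
  · rintro n s ⟨h1, h2⟩
    simp only [Set.mem_ofPred_eq, Metric.mem_ball, dist_zero_right] at h1 h2
    refine (norm_zetaRemainder_le n.succ_ne_zero (by linarith)).trans ?_
    have : ‖s - 1‖ ≤ ‖s₀‖ + 2 := (norm_sub_le _ _).trans (by simp; linarith)
    gcongr
    simp

lemma sum_zetaRemainder (s : ℂ) (N M : ℕ) :
    ∑ n ∈ Finset.range M, zetaRemainder (n + N) s =
      (s - 1) * ∑ n ∈ Finset.range M, ((n + N + 1 : ℕ) : ℂ) ^ (-s)
        + ((M + N : ℕ) : ℂ) ^ (1 - s) - (N : ℂ) ^ (1 - s) := by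
  induction M with
  | zero => simp
  | succ M ih =>
    rw [Finset.sum_range_succ, ih, Finset.sum_range_succ, zetaRemainder,
      show M + 1 + N = M + N + 1 by ring]
    ring

lemma zetaMulSubOne_eq_of_one_lt {s : ℂ} (hs : 1 < s.re) :
    zetaMulSubOne s = s + ∑' n : ℕ, zetaRemainder (n + 1) s := by
  have hs1 : s ≠ 1 := by rintro rfl; simp at hs
  have hsum : Summable fun n : ℕ => zetaRemainder (n + 1) s :=
    (summable_norm_zetaRemainder one_ne_zero (by linarith)).of_norm
  have h1 := hsum.hasSum.tendsto_sum_nat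
  have h2 : Filter.Tendsto (fun M : ℕ => ∑ n ∈ Finset.range M, zetaRemainder (n + 1) s)
      Filter.atTop (nhds ((s - 1) * (riemannZeta s - 1) + 0 - 1)) := by
    simp_rw [sum_zetaRemainder]
    refine Filter.Tendsto.sub (Filter.Tendsto.add (Filter.Tendsto.const_mul _ ?_) ?_) (by simp)
    · have h3 : Summable fun n : ℕ => ((n + 1 : ℕ) : ℂ) ^ (-s) := by
        have := (summable_nat_add_iff (f := fun n : ℕ => 1 / (n : ℂ) ^ s) 1).mpr
          (Complex.summable_one_div_nat_cpow.mpr hs)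
        simpa [Complex.cpow_neg] using this
      have h4 : riemannZeta s = ∑' n : ℕ, ((n + 1 : ℕ) : ℂ) ^ (-s) := by
        rw [zeta_eq_tsum_one_div_nat_add_one_cpow hs]
        simp [Complex.cpow_neg]
      have h5 := (h3.hasSum.tendsto_sum_nat).comp (Filter.tendsto_add_atTop_nat 1)
      rw [← h4] at h5
      have h6 := h5.sub_const 1
      refine h6.congr fun M => ?_
      simp [Finset.sum_range_succ']
    · rw [tendsto_zero_iff_norm_tendsto_zero]
      have : Filter.Tendsto (fun M : ℕ => ((M + 1 : ℕ) : ℝ) ^ (-(s.re - 1)))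
          Filter.atTop (nhds 0) :=
        (tendsto_rpow_neg_atTop (by linarith)).comp
          (tendsto_natCast_atTop_atTop.comp (Filter.tendsto_add_atTop_nat 1))
      refine this.congr fun M => ?_
      rw [Complex.norm_natCast_cpow_of_pos (by omega)]
      simp
  rw [tendsto_nhds_unique h1 h2, zetaMulSubOne_of_ne hs1]
  ring

lemma zetaMulSubOne_eq {s : ℂ} (hs : 0 < s.re) :
    zetaMulSubOne s = s + ∑' n : ℕ, zetaRemainder (n + 1) s := by
  have ho : IsOpen {s : ℂ | 0 < s.re} := isOpen_lt continuous_const Complex.continuous_re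
  have h1 : AnalyticOnNhd ℂ zetaMulSubOne {s : ℂ | 0 < s.re} :=
    differentiable_zetaMulSubOne.differentiableOn.analyticOnNhd ho
  have h2 : AnalyticOnNhd ℂ (fun s => s + ∑' n : ℕ, zetaRemainder (n + 1) s)
      {s : ℂ | 0 < s.re} :=
    (differentiableOn_id.add differentiableOn_tsum_zetaRemainder).analyticOnNhd ho
  refine h1.eqOn_of_preconnected_of_eventuallyEq h2 (convex_halfSpace_re_gt 0).isPreconnected
    (z₀ := 2) (by simp) ?_ hs
  filter_upwards [(isOpen_lt continuous_const Complex.continuous_re).mem_nhds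
    (show (1 : ℝ) < (2 : ℂ).re by simp)] with z hz
  exact zetaMulSubOne_eq_of_one_lt hz

lemma zetaMulSubOne_eq_sum_add {s : ℂ} (hs : 0 < s.re) {N : ℕ} (hN : N ≠ 0) :
    zetaMulSubOne s = (s - 1) * ∑ n ∈ Finset.range N, ((n + 1 : ℕ) : ℂ) ^ (-s)
      + (N : ℂ) ^ (1 - s) + ∑' n : ℕ, zetaRemainder (n + N) s := by
  obtain ⟨M, rfl⟩ := Nat.exists_eq_succ_of_ne_zero hN
  have hsum : Summable fun n : ℕ => zetaRemainder (n + 1) s :=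
    (summable_norm_zetaRemainder one_ne_zero hs).of_norm
  rw [zetaMulSubOne_eq hs, ← hsum.sum_add_tsum_nat_add M, sum_zetaRemainder,
    Finset.sum_range_succ']
  simp only [Nat.succ_eq_add_one, add_assoc]
  push_cast
  simp only [Complex.one_cpow]
  ring

lemma tsum_norm_zetaRemainder_le {N : ℕ} (hN : N ≠ 0) {s : ℂ} (hs : 1 / 2 ≤ s.re)
    (hs' : s.re ≤ 3) :
    ∑' n : ℕ, ‖zetaRemainder (n + N) s‖ ≤ ‖s - 1‖ * ‖s‖ * (32 * (N : ℝ) ^ (-s.re)) := by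
  refine Real.tsum_le_of_sum_range_le (fun _ => norm_nonneg _) fun M => ?_
  have key : ∀ n : ℕ, ‖zetaRemainder (n + N) s‖ ≤ ‖s - 1‖ * ‖s‖ *
      (32 * (((n + N : ℕ) : ℝ) ^ (-s.re) - ((n + 1 + N : ℕ) : ℝ) ^ (-s.re))) := by
    intro n
    refine (norm_zetaRemainder_le (by omega) (by linarith)).trans ?_
    refine mul_le_mul_of_nonneg_left ?_ (by positivity)
    have h0 : 0 < n + N := by omega
    have h1 := mul_rpow_neg_sub_one_le (σ := s.re) (n := n + N) (by omega) (by linarith)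
    rw [show n + 1 + N = n + N + 1 by ring]
    set m := n + N
    have hm0 : (1 : ℝ) ≤ m := by exact_mod_cast h0
    have h2 : (m : ℝ) ^ (-s.re - 1) ≤ 16 * ((m + 1 : ℕ) : ℝ) ^ (-s.re - 1) := by
      have h3 : (2 * (m : ℝ)) ^ (-s.re - 1) ≤ ((m + 1 : ℕ) : ℝ) ^ (-s.re - 1) :=
        Real.rpow_le_rpow_of_nonpos (by positivity) (by push_cast; linarith) (by linarith)
      rw [Real.mul_rpow (by norm_num) (by linarith)] at h3
      have h4 : (2 : ℝ) ^ (-4 : ℝ) ≤ 2 ^ (-s.re - 1) :=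
        Real.rpow_le_rpow_of_exponent_le (by norm_num) (by linarith)
      have h5 : (2 : ℝ) ^ (-4 : ℝ) = 1 / 16 := by
        rw [Real.rpow_neg (by norm_num)]; norm_num
      have h6 : 0 ≤ (m : ℝ) ^ (-s.re - 1) := by positivity
      rw [h5] at h4
      have h8 := mul_le_mul_of_nonneg_right h4 h6
      linarith
    have h7 : 0 ≤ ((m + 1 : ℕ) : ℝ) ^ (-s.re - 1) := by positivity
    nlinarith
  refine (Finset.sum_le_sum fun n _ => key n).trans ?_
  rw [← Finset.mul_sum, ← Finset.mul_sum,
    Finset.sum_range_sub' (fun n => ((n + N : ℕ) : ℝ) ^ (-s.re))]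
  refine mul_le_mul_of_nonneg_left ?_ (by positivity)
  have : 0 ≤ ((M + N : ℕ) : ℝ) ^ (-s.re) := by positivity
  simp only [zero_add]
  linarith

lemma sum_rpow_neg_le {σ : ℝ} (hσ : 99 / 100 ≤ σ) {N : ℕ} (hN : N ≠ 0) {t : ℝ} (hNt : (N : ℝ) ≤ t) :
    ∑ n ∈ Finset.range N, ((n + 1 : ℕ) : ℝ) ^ (-σ) ≤ 101 * t ^ (1 / 50 : ℝ) := by
  have hN1 : (1 : ℝ) ≤ N := by exact_mod_cast Nat.one_le_iff_ne_zero.mpr hN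
  have ht1 : 1 ≤ t := hN1.trans hNt
  have h1 : ∀ n ∈ Finset.range N, ((n + 1 : ℕ) : ℝ) ^ (-σ) ≤ t ^ (1 / 100 : ℝ) * ((n : ℝ) + 1)⁻¹ := by
    intro n hn
    have hn1 : (1 : ℝ) ≤ ((n + 1 : ℕ) : ℝ) := by push_cast; linarith [n.cast_nonneg (α := ℝ)]
    have hnN : ((n + 1 : ℕ) : ℝ) ≤ t := by
      refine le_trans ?_ hNt
      exact_mod_cast Finset.mem_range.mp hn
    calc ((n + 1 : ℕ) : ℝ) ^ (-σ) ≤ ((n + 1 : ℕ) : ℝ) ^ (1 / 100 - 1 : ℝ) :=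
          Real.rpow_le_rpow_of_exponent_le hn1 (by linarith)
      _ = ((n + 1 : ℕ) : ℝ) ^ (1 / 100 : ℝ) * ((n : ℝ) + 1)⁻¹ := by
          rw [Real.rpow_sub_one (by positivity)]; push_cast; rfl
      _ ≤ _ := by gcongr
  refine (Finset.sum_le_sum h1).trans ?_
  rw [← Finset.mul_sum]
  have h2 : ∑ n ∈ Finset.range N, ((n : ℝ) + 1)⁻¹ ≤ 1 + Real.log N := by
    have := harmonic_le_one_add_log N
    simpa [harmonic] using this
  have h3 : Real.log N ≤ Real.log t := Real.log_le_log (by linarith) hNt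
  have h4 := Real.log_le_rpow_div (x := t) (by linarith) (show (0 : ℝ) < 1 / 100 by norm_num)
  have h5 : 1 ≤ t ^ (1 / 100 : ℝ) := Real.one_le_rpow ht1 (by norm_num)
  have h6 : t ^ (1 / 50 : ℝ) = t ^ (1 / 100 : ℝ) * t ^ (1 / 100 : ℝ) := by
    rw [← Real.rpow_add (by linarith)]; norm_num
  rw [h6]
  nlinarith

lemma norm_riemannZeta_le {s : ℂ} (h1 : 99 / 100 ≤ s.re) (h3 : s.re ≤ 3) (ht : 1 ≤ |s.im|) :
    ‖riemannZeta s‖ ≤ 400 * |s.im| ^ (1 / 50 : ℝ) := by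
  have hs1 : s ≠ 1 := by rintro rfl; norm_num at ht
  have hs1' : s - 1 ≠ 0 := sub_ne_zero.mpr hs1
  set t := |s.im| with ht_def
  set N := ⌊t⌋₊ with hN_def
  have hN : N ≠ 0 := (Nat.floor_pos.mpr ht).ne'
  have hNt : (N : ℝ) ≤ t := Nat.floor_le (by linarith)
  have hN1 : (1 : ℝ) ≤ N := by exact_mod_cast Nat.one_le_iff_ne_zero.mpr hN
  have htN : t ≤ 2 * N := by have := Nat.lt_floor_add_one t; linarith
  have hs1t : 1 ≤ ‖s - 1‖ := by
    refine le_trans ht ?_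
    have := Complex.abs_im_le_norm (s - 1)
    simpa using this
  have hst : ‖s‖ ≤ 4 * t := by
    refine (Complex.norm_le_abs_re_add_abs_im s).trans ?_
    rw [abs_of_nonneg (by linarith)]; linarith
  have key : riemannZeta s = ∑ n ∈ Finset.range N, ((n + 1 : ℕ) : ℂ) ^ (-s)
      + (N : ℂ) ^ (1 - s) / (s - 1) + (∑' n : ℕ, zetaRemainder (n + N) s) / (s - 1) := by
    have := zetaMulSubOne_eq_sum_add (s := s) (by linarith) hN
    rw [zetaMulSubOne_of_ne hs1] at this
    field_simp
    linear_combination this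
  have hb : (N : ℝ) ^ (1 - s.re) ≤ t ^ (1 / 50 : ℝ) := by
    calc (N : ℝ) ^ (1 - s.re) ≤ (N : ℝ) ^ (1 / 50 : ℝ) :=
          Real.rpow_le_rpow_of_exponent_le hN1 (by linarith)
      _ ≤ _ := Real.rpow_le_rpow (by linarith) hNt (by norm_num)
  have hN1s : 0 ≤ (N : ℝ) ^ (-s.re) := by positivity
  have hNs : (N : ℝ) * (N : ℝ) ^ (-s.re) = (N : ℝ) ^ (1 - s.re) := by
    rw [show 1 - s.re = -s.re + 1 by ring, Real.rpow_add_one (by linarith)]; ring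
  have b1 : ‖∑ n ∈ Finset.range N, ((n + 1 : ℕ) : ℂ) ^ (-s)‖ ≤ 101 * t ^ (1 / 50 : ℝ) := by
    refine (norm_sum_le _ _).trans (le_trans (le_of_eq ?_) (sum_rpow_neg_le h1 hN hNt))
    refine Finset.sum_congr rfl fun n _ => ?_
    rw [Complex.norm_natCast_cpow_of_pos n.succ_pos]; simp
  have b2 : ‖(N : ℂ) ^ (1 - s) / (s - 1)‖ ≤ t ^ (1 / 50 : ℝ) := by
    rw [norm_div, Complex.norm_natCast_cpow_of_pos (Nat.pos_of_ne_zero hN)]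
    refine (div_le_self (by positivity) hs1t).trans ?_
    simpa using hb
  have b3 : ‖(∑' n : ℕ, zetaRemainder (n + N) s) / (s - 1)‖ ≤ 256 * t ^ (1 / 50 : ℝ) := by
    rw [norm_div, div_le_iff₀ (by linarith)]
    refine (norm_tsum_le_tsum_norm (summable_norm_zetaRemainder hN (by linarith))).trans ?_
    refine (tsum_norm_zetaRemainder_le hN (by linarith) h3).trans ?_
    have : ‖s‖ * (32 * (N : ℝ) ^ (-s.re)) ≤ 256 * t ^ (1 / 50 : ℝ) := by
      calc ‖s‖ * (32 * (N : ℝ) ^ (-s.re)) ≤ (4 * (2 * N)) * (32 * (N : ℝ) ^ (-s.re)) := by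
            gcongr; linarith
        _ = 256 * (N : ℝ) ^ (1 - s.re) := by rw [← hNs]; ring
        _ ≤ _ := by linarith
    rw [mul_assoc, mul_comm]
    exact mul_le_mul_of_nonneg_right this (norm_nonneg _)
  rw [key]
  refine (norm_add₃_le).trans ?_
  have : 0 ≤ t ^ (1 / 50 : ℝ) := by positivity
  linarith

lemma rpow_le_two_mul_rpow {t u a : ℝ} (hu : 0 ≤ u) (ht : 0 ≤ t) (hut : u ≤ 2 * t) (ha : 0 ≤ a)
    (ha1 : a ≤ 1) : u ^ a ≤ 2 * t ^ a := by
  calc u ^ a ≤ (2 * t) ^ a := Real.rpow_le_rpow hu hut ha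
    _ = 2 ^ a * t ^ a := Real.mul_rpow (by norm_num) ht
    _ ≤ 2 * t ^ a := by
      gcongr
      calc (2 : ℝ) ^ a ≤ 2 ^ (1 : ℝ) := Real.rpow_le_rpow_of_exponent_le (by norm_num) ha1
        _ = 2 := by norm_num

lemma re_im_bounds_of_mem_closedBall {s z : ℂ} {R : ℝ} (hz : z ∈ Metric.closedBall s R) :
    s.re - R ≤ z.re ∧ z.re ≤ s.re + R ∧ |s.im| - R ≤ |z.im| ∧ |z.im| ≤ |s.im| + R := by
  rw [Metric.mem_closedBall, dist_eq_norm] at hz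
  have h1 := abs_le.mp ((Complex.abs_re_le_norm (z - s)).trans hz)
  have h2 := (Complex.abs_im_le_norm (z - s)).trans hz
  rw [Complex.sub_im] at h2
  rw [Complex.sub_re] at h1
  have h3 := abs_sub_abs_le_abs_sub z.im s.im
  have h4 := abs_sub_abs_le_abs_sub s.im z.im
  rw [abs_sub_comm] at h4
  refine ⟨by linarith, by linarith, by linarith, by linarith⟩

lemma norm_deriv_riemannZeta_le {s : ℂ} (h1 : 199 / 200 ≤ s.re) (h2 : s.re ≤ 2)
    (ht : 2 ≤ |s.im|) : ‖deriv riemannZeta s‖ ≤ 160000 * |s.im| ^ (1 / 50 : ℝ) := by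
  have hne : ∀ z ∈ Metric.closedBall s (1 / 200), z ≠ 1 := by
    rintro z hz rfl
    have := (re_im_bounds_of_mem_closedBall hz).2.2.1
    norm_num at this; linarith
  have := Complex.norm_deriv_le_of_forall_mem_sphere_norm_le (c := s) (R := 1 / 200)
    (C := 800 * |s.im| ^ (1 / 50 : ℝ)) (f := riemannZeta) (by norm_num) ?_ ?_
  · refine this.trans (le_of_eq ?_); ring
  · refine DifferentiableOn.diffContOnCl fun z hz => ?_
    refine (differentiableAt_riemannZeta (hne z ?_)).differentiableWithinAt
    exact Metric.closure_ball_subset_closedBall hz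
  · intro z hz
    obtain ⟨a1, a2, a3, a4⟩ := re_im_bounds_of_mem_closedBall (Metric.sphere_subset_closedBall hz)
    refine (norm_riemannZeta_le (by linarith) (by linarith) (by linarith)).trans ?_
    have := rpow_le_two_mul_rpow (u := |z.im|) (t := |s.im|) (a := 1 / 50) (abs_nonneg _)
      (abs_nonneg _) (by linarith) (by norm_num) (by norm_num)
    linarith

lemma exists_norm_riemannZeta_one_add_le :
    ∃ K : ℝ, 0 < K ∧ ∀ x : ℝ, 0 < x → x ≤ 1 → ‖riemannZeta (1 + x)‖ ≤ K / x := by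
  obtain ⟨K, hK⟩ := (isCompact_Icc (a := (0 : ℝ)) (b := 1)).exists_bound_of_continuousOn
    (f := fun x : ℝ => zetaMulSubOne (1 + x))
    (differentiable_zetaMulSubOne.continuous.comp (by fun_prop)).continuousOn
  refine ⟨max K 1, by positivity, fun x hx hx1 => ?_⟩
  have h := hK x ⟨hx.le, hx1⟩
  have hne : (1 + x : ℂ) ≠ 1 := by
    simpa using hx.ne'
  rw [zetaMulSubOne_of_ne hne, norm_mul] at h
  have : ‖(1 + x : ℂ) - 1‖ = x := by simp [abs_of_pos hx]
  rw [this] at h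
  rw [le_div_iff₀ hx]
  have := le_max_left K 1
  linarith

lemma exists_le_norm_riemannZeta_pow_four :
    ∃ c : ℝ, 0 < c ∧ ∀ s : ℂ, 1 < s.re → s.re ≤ 2 → 1 ≤ |s.im| →
      c * (s.re - 1) ^ 3 * |s.im| ^ (-(1 / 50) : ℝ) ≤ ‖riemannZeta s‖ ^ 4 := by
  obtain ⟨K, hK0, hK⟩ := exists_norm_riemannZeta_one_add_le
  refine ⟨1 / (K ^ 3 * 800), by positivity, fun s h1 h2 ht => ?_⟩
  obtain ⟨x, hx⟩ : ∃ x : ℝ, x = s.re - 1 := ⟨_, rfl⟩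
  have hx0 : 0 < x := by linarith
  have h := DirichletCharacter.norm_LFunction_product_ge_one (N := 1) 1 hx0 s.im
  rw [one_pow, DirichletCharacter.LFunctionTrivChar, DirichletCharacter.LFunction_modOne_eq] at h
  have e1 : (1 + x + Complex.I * s.im : ℂ) = s := by
    apply Complex.ext <;> simp [hx]
  rw [e1, norm_mul, norm_mul, norm_pow, norm_pow] at h
  set w : ℂ := 1 + x + 2 * Complex.I * s.im with hw
  have hwre : w.re = 1 + x := by simp [hw]
  have hwim : w.im = 2 * s.im := by simp [hw]
  have hwabs : |w.im| = 2 * |s.im| := by rw [hwim, abs_mul]; norm_num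
  have b3 : ‖riemannZeta w‖ ≤ 800 * |s.im| ^ (1 / 50 : ℝ) := by
    refine (norm_riemannZeta_le (by linarith) (by linarith) (by linarith)).trans ?_
    have := rpow_le_two_mul_rpow (u := |w.im|) (t := |s.im|) (a := 1 / 50) (abs_nonneg _)
      (abs_nonneg _) (by linarith) (by norm_num) (by norm_num)
    linarith
  have b1 : ‖riemannZeta (1 + x)‖ ^ 3 ≤ (K / x) ^ 3 :=
    pow_le_pow_left₀ (norm_nonneg _) (hK x hx0 (by linarith)) 3
  have ht0 : 0 < |s.im| := by linarith
  have htp : 0 < |s.im| ^ (1 / 50 : ℝ) := by positivity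
  have : 1 ≤ (K / x) ^ 3 * ‖riemannZeta s‖ ^ 4 * (800 * |s.im| ^ (1 / 50 : ℝ)) :=
    h.le.trans (by gcongr)
  rw [Real.rpow_neg ht0.le, ← hx]
  calc 1 / (K ^ 3 * 800) * x ^ 3 * (|s.im| ^ (1 / 50 : ℝ))⁻¹
      = 1 / (K ^ 3 * 800) * x ^ 3 * (|s.im| ^ (1 / 50 : ℝ))⁻¹ * 1 := by ring
    _ ≤ 1 / (K ^ 3 * 800) * x ^ 3 * (|s.im| ^ (1 / 50 : ℝ))⁻¹ *
        ((K / x) ^ 3 * ‖riemannZeta s‖ ^ 4 * (800 * |s.im| ^ (1 / 50 : ℝ))) := by gcongr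
    _ = ‖riemannZeta s‖ ^ 4 := by field_simp

lemma exists_le_norm_riemannZeta :
    ∃ ε c : ℝ, 0 < ε ∧ ε ≤ 1 / 200 ∧ 0 < c ∧ ∀ s : ℂ, 2 ≤ |s.im| →
      1 - ε * |s.im| ^ (-(1 / 10) : ℝ) ≤ s.re → s.re ≤ 2 →
      c * |s.im| ^ (-(2 / 25) : ℝ) ≤ ‖riemannZeta s‖ := by
  obtain ⟨c₀, hc₀, hlow⟩ := exists_le_norm_riemannZeta_pow_four
  obtain ⟨ε, hε⟩ : ∃ ε : ℝ, ε = min (c₀ / 640000 ^ 4) (1 / 200) := ⟨_, rfl⟩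
  have hε0 : 0 < ε := by rw [hε]; positivity
  have hε1 : ε ≤ 1 / 200 := hε ▸ min_le_right _ _
  have hε2 : ε * 640000 ^ 4 ≤ c₀ := by
    rw [← le_div_iff₀ (by positivity)]; exact hε ▸ min_le_left _ _
  obtain ⟨b, hb⟩ : ∃ b : ℝ, b = (c₀ * ε ^ 3) ^ (1 / 4 : ℝ) := ⟨_, rfl⟩
  have hb0 : 0 < b := by rw [hb]; positivity
  have hb4 : b ^ 4 = c₀ * ε ^ 3 := by
    rw [hb, ← Real.rpow_natCast, ← Real.rpow_mul (by positivity)]; norm_num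
  have hεb : 640000 * ε ≤ b := by
    refine le_of_pow_le_pow_left₀ (n := 4) (by norm_num) hb0.le ?_
    rw [hb4, mul_pow]
    calc 640000 ^ 4 * ε ^ 4 = (ε * 640000 ^ 4) * ε ^ 3 := by ring
      _ ≤ c₀ * ε ^ 3 := by gcongr
  refine ⟨ε, b / 2, hε0, hε1, by positivity, fun s ht h1 h2 => ?_⟩
  obtain ⟨t, htdef⟩ : ∃ t, t = |s.im| := ⟨_, rfl⟩
  rw [← htdef] at ht h1 ⊢
  have ht0 : 0 < t := by linarith
  have htr : t ^ (-(1 / 10) : ℝ) ≤ 1 := Real.rpow_le_one_of_one_le_of_nonpos (by linarith)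
    (by norm_num)
  have htr0 : 0 < t ^ (-(1 / 10) : ℝ) := by positivity
  obtain ⟨d, hd⟩ : ∃ d, d = ε * t ^ (-(1 / 10) : ℝ) := ⟨_, rfl⟩
  have hd0 : 0 < d := by rw [hd]; positivity
  have hd1 : d ≤ 1 / 200 := by rw [hd]; nlinarith
  have main : ∀ z : ℂ, |z.im| = t → 1 + d ≤ z.re → z.re ≤ 2 →
      b * t ^ (-(2 / 25) : ℝ) ≤ ‖riemannZeta z‖ := by
    intro z hzi hz1 hz2
    have h := hlow z (by linarith) hz2 (by linarith)
    rw [hzi] at h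
    refine le_of_pow_le_pow_left₀ (n := 4) (by norm_num) (norm_nonneg _) (le_trans ?_ h)
    have e1 : (b * t ^ (-(2 / 25) : ℝ)) ^ 4 = c₀ * d ^ 3 * t ^ (-(1 / 50) : ℝ) := by
      rw [mul_pow, hb4, hd, mul_pow, ← Real.rpow_natCast (t ^ (-(2 / 25) : ℝ)),
        ← Real.rpow_natCast (t ^ (-(1 / 10) : ℝ)), ← Real.rpow_mul ht0.le, ← Real.rpow_mul ht0.le]
      rw [show c₀ * (ε ^ 3 * t ^ (-(1 / 10) * ((3 : ℕ) : ℝ))) * t ^ (-(1 / 50) : ℝ) =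
        c₀ * ε ^ 3 * (t ^ (-(1 / 10) * ((3 : ℕ) : ℝ)) * t ^ (-(1 / 50) : ℝ)) by ring,
        ← Real.rpow_add ht0]
      norm_num
    rw [e1]
    have : d ≤ z.re - 1 := by linarith
    gcongr
  have htp : 0 < t ^ (-(2 / 25) : ℝ) := by positivity
  by_cases hre : 1 + d ≤ s.re
  · have := main s htdef.symm hre h2
    have : 0 < b * t ^ (-(2 / 25) : ℝ) := by positivity
    linarith
  push Not at hre
  obtain ⟨z, hz⟩ : ∃ z : ℂ, z = ⟨1 + d, s.im⟩ := ⟨_, rfl⟩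
  have hzim : z.im = s.im := by rw [hz]
  have hzre : z.re = 1 + d := by rw [hz]
  have hz1 := main z (by rw [hzim, htdef]) (by rw [hzre]) (by rw [hzre]; linarith)
  have hdist : ‖s - z‖ ≤ 2 * d := by
    refine (Complex.norm_le_abs_re_add_abs_im _).trans ?_
    rw [Complex.sub_re, Complex.sub_im, hzim, hzre, sub_self, abs_zero, add_zero, abs_le]
    constructor <;> linarith
  have hmv := Convex.norm_image_sub_le_of_norm_deriv_le (f := riemannZeta)
    (s := {w : ℂ | 1 - d ≤ w.re} ∩ {w : ℂ | w.re ≤ 2} ∩ {w : ℂ | w.im = s.im}) (x := z) (y := s)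
    (C := 160000 * t ^ (1 / 50 : ℝ)) ?_ ?_ ?_ ?_ ?_
  · have h3 : 160000 * t ^ (1 / 50 : ℝ) * ‖s - z‖ ≤ b / 2 * t ^ (-(2 / 25) : ℝ) := by
      calc 160000 * t ^ (1 / 50 : ℝ) * ‖s - z‖ ≤ 160000 * t ^ (1 / 50 : ℝ) * (2 * d) := by gcongr
        _ = 320000 * ε * (t ^ (1 / 50 : ℝ) * t ^ (-(1 / 10) : ℝ)) := by rw [hd]; ring
        _ = 320000 * ε * t ^ (-(2 / 25) : ℝ) := by rw [← Real.rpow_add ht0]; norm_num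
        _ ≤ _ := by gcongr; linarith
    have h4 := norm_sub_norm_le (riemannZeta z) (riemannZeta s)
    rw [norm_sub_rev] at h4
    linarith
  · rintro w ⟨-, hw⟩
    refine differentiableAt_riemannZeta ?_
    rintro rfl
    simp only [Set.mem_ofPred_eq, Complex.one_im] at hw
    rw [← hw, abs_zero] at htdef
    linarith
  · rintro w ⟨⟨hw1, hw2⟩, hw3⟩
    simp only [Set.mem_ofPred_eq] at hw1 hw2 hw3
    have := norm_deriv_riemannZeta_le (s := w) (by linarith) hw2 (by rw [hw3, ← htdef]; exact ht)
    rwa [hw3, ← htdef] at this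
  · refine ((convex_halfSpace_re_ge _).inter (convex_halfSpace_re_le _)).inter ?_
    exact convex_hyperplane Complex.imLm.isLinear _
  · refine ⟨⟨?_, ?_⟩, hzim⟩ <;> simp only [Set.mem_ofPred_eq, hzre] <;> linarith
  · refine ⟨⟨?_, ?_⟩, rfl⟩ <;> simp only [Set.mem_ofPred_eq] <;> linarith

/-- The regularised function `-deriv ζ / ζ - ζ`, extended analytically across `s = 1`. -/
noncomputable def negLogDerivZetaSubZeta (s : ℂ) : ℂ :=
  -deriv zetaMulSubOne s / zetaMulSubOne s - dslope zetaMulSubOne 1 s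

lemma negLogDerivZetaSubZeta_eq {s : ℂ} (hs : s ≠ 1) (h0 : riemannZeta s ≠ 0) :
    negLogDerivZetaSubZeta s = -deriv riemannZeta s / riemannZeta s - riemannZeta s := by
  have hd : deriv zetaMulSubOne s = riemannZeta s + (s - 1) * deriv riemannZeta s := by
    have : zetaMulSubOne =ᶠ[nhds s] fun z => (z - 1) * riemannZeta z := by
      filter_upwards [isOpen_ne.mem_nhds hs] with z hz
      exact zetaMulSubOne_of_ne hz
    rw [this.deriv_eq]
    have := ((hasDerivAt_id' s).sub_const 1).fun_mul (differentiableAt_riemannZeta hs).hasDerivAt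
    simpa using this.deriv
  have h1 : s - 1 ≠ 0 := sub_ne_zero.mpr hs
  rw [negLogDerivZetaSubZeta, hd, dslope_of_ne _ hs, slope_def_field, zetaMulSubOne_one,
    zetaMulSubOne_of_ne hs]
  field_simp
  ring

lemma differentiableAt_negLogDerivZetaSubZeta {s : ℂ} (hs : zetaMulSubOne s ≠ 0) :
    DifferentiableAt ℂ negLogDerivZetaSubZeta s := by
  have h1 : Differentiable ℂ (dslope zetaMulSubOne 1) := by
    rw [← differentiableOn_univ]
    exact (Complex.differentiableOn_dslope Filter.univ_mem).mpr
      differentiable_zetaMulSubOne.differentiableOn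
  have h2 : Differentiable ℂ (deriv zetaMulSubOne) := by
    have := (differentiable_zetaMulSubOne.contDiff (n := 2))
    exact (contDiff_succ_iff_deriv (n := 1).mp this).2.2.differentiable (by simp)
  exact ((h2 s).neg.div (differentiable_zetaMulSubOne s) hs).sub (h1 s)

lemma analyticAt_negLogDerivZetaSubZeta {s : ℂ} (hs : zetaMulSubOne s ≠ 0) :
    AnalyticAt ℂ negLogDerivZetaSubZeta s := by
  rw [Complex.analyticAt_iff_eventually_differentiableAt]
  filter_upwards [differentiable_zetaMulSubOne.continuous.continuousAt.eventually_ne hs] with z hz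
  exact differentiableAt_negLogDerivZetaSubZeta hz

lemma exists_norm_iteratedDeriv_le_of_three_le_abs_im :
    ∃ C : ℝ, 0 ≤ C ∧ ∀ s : ℂ, 1 ≤ s.re → s.re ≤ 3 / 2 → 3 ≤ |s.im| →
      ‖iteratedDeriv 4 negLogDerivZetaSubZeta s‖ ≤ C * |s.im| ^ (1 / 2 : ℝ) := by
  obtain ⟨ε, c, hε, hε1, hc, hζ⟩ := exists_le_norm_riemannZeta
  refine ⟨24 * ((160000 / c + 400) * 2) / (ε / 2) ^ 4, by positivity, ?_⟩
  intro s h1 h2 h3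
  obtain ⟨t, ht⟩ : ∃ t, t = |s.im| := ⟨_, rfl⟩
  rw [← ht] at h3 ⊢
  have ht0 : 0 < t := by linarith
  obtain ⟨R, hR⟩ : ∃ R, R = ε / 2 * t ^ (-(1 / 10) : ℝ) := ⟨_, rfl⟩
  have hR0 : 0 < R := by rw [hR]; positivity
  have htr : t ^ (-(1 / 10) : ℝ) ≤ 1 := Real.rpow_le_one_of_one_le_of_nonpos (by linarith)
    (by norm_num)
  have hR1 : R ≤ 1 / 400 := by rw [hR]; nlinarith [Real.rpow_pos_of_pos ht0 (-(1 / 10))]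
  have key : ∀ z ∈ Metric.closedBall s R, z ≠ 1 ∧ riemannZeta z ≠ 0 ∧
      ‖negLogDerivZetaSubZeta z‖ ≤ (160000 / c + 400) * 2 * t ^ (1 / 10 : ℝ) := by
    intro z hz
    obtain ⟨a1, a2, a3, a4⟩ := re_im_bounds_of_mem_closedBall hz
    rw [← ht] at a3 a4
    obtain ⟨u, hu⟩ : ∃ u, u = |z.im| := ⟨_, rfl⟩
    rw [← hu] at a3 a4
    have hu2 : 2 ≤ u := by linarith
    have hu0 : 0 < u := by linarith
    have hz1 : z ≠ 1 := by rintro rfl; simp at hu; linarith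
    have hur : u ^ (1 / 10 : ℝ) ≤ 2 * t ^ (1 / 10 : ℝ) :=
      rpow_le_two_mul_rpow hu0.le ht0.le (by linarith) (by norm_num) (by norm_num)
    have hur' : t ^ (-(1 / 10) : ℝ) ≤ 2 * u ^ (-(1 / 10) : ℝ) := by
      rw [Real.rpow_neg ht0.le, Real.rpow_neg hu0.le]
      have := Real.rpow_pos_of_pos hu0 (1 / 10)
      have := Real.rpow_pos_of_pos ht0 (1 / 10)
      rw [inv_eq_one_div, ← div_eq_mul_inv, div_le_div_iff₀ (by assumption) (by assumption)]
      linarith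
    have hlow := hζ z (by rw [← hu]; exact hu2) (by
      rw [← hu]
      have : R ≤ ε * u ^ (-(1 / 10) : ℝ) := by rw [hR]; nlinarith
      linarith) (by linarith)
    rw [← hu] at hlow
    have hup : 0 < c * u ^ (-(2 / 25) : ℝ) := by positivity
    have hz0 : riemannZeta z ≠ 0 := by
      intro h
      rw [h, norm_zero] at hlow
      linarith
    refine ⟨hz1, hz0, ?_⟩
    rw [negLogDerivZetaSubZeta_eq hz1 hz0]
    have b1 := norm_riemannZeta_le (s := z) (by linarith) (by linarith) (by rw [← hu]; linarith)
    have b2 := norm_deriv_riemannZeta_le (s := z) (by linarith) (by linarith)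
      (by rw [← hu]; linarith)
    rw [← hu] at b1 b2
    have b3 : ‖-deriv riemannZeta z / riemannZeta z‖ ≤ 160000 / c * u ^ (1 / 10 : ℝ) := by
      rw [norm_div, norm_neg]
      calc ‖deriv riemannZeta z‖ / ‖riemannZeta z‖
          ≤ 160000 * u ^ (1 / 50 : ℝ) / (c * u ^ (-(2 / 25) : ℝ)) := by gcongr
        _ = 160000 / c * (u ^ (1 / 50 : ℝ) / u ^ (-(2 / 25) : ℝ)) := by field_simp
        _ = _ := by rw [← Real.rpow_sub hu0]; norm_num
    have b4 : u ^ (1 / 50 : ℝ) ≤ u ^ (1 / 10 : ℝ) :=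
      Real.rpow_le_rpow_of_exponent_le (by linarith) (by norm_num)
    calc _ ≤ 160000 / c * u ^ (1 / 10 : ℝ) + 400 * u ^ (1 / 10 : ℝ) := by
          refine (norm_sub_le _ _).trans (add_le_add b3 (b1.trans ?_))
          gcongr
      _ = (160000 / c + 400) * u ^ (1 / 10 : ℝ) := by ring
      _ ≤ (160000 / c + 400) * (2 * t ^ (1 / 10 : ℝ)) := by gcongr
      _ = _ := by ring
  have hZ : ∀ z ∈ Metric.closedBall s R, zetaMulSubOne z ≠ 0 := by
    intro z hz
    rw [zetaMulSubOne_of_ne (key z hz).1]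
    exact mul_ne_zero (sub_ne_zero.mpr (key z hz).1) (key z hz).2.1
  have hcl : DiffContOnCl ℂ negLogDerivZetaSubZeta (Metric.ball s R) := by
    apply DifferentiableOn.diffContOnCl_ball (U := Metric.closedBall s R) _ subset_rfl
    intro z hz
    exact (differentiableAt_negLogDerivZetaSubZeta (hZ z hz)).differentiableWithinAt
  have := Complex.norm_iteratedDeriv_le_of_forall_mem_sphere_norm_le 4 hR0 hcl
    (fun z hz => (key z (Metric.sphere_subset_closedBall hz)).2.2)
  refine this.trans (le_of_eq ?_)
  have e : R ^ 4 = (ε / 2) ^ 4 * t ^ (-(4 / 10) : ℝ) := by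
    rw [hR, mul_pow, ← Real.rpow_natCast (t ^ _), ← Real.rpow_mul ht0.le]
    norm_num
  rw [e, show (1 / 2 : ℝ) = 1 / 10 - (-(4 / 10)) by norm_num, Real.rpow_sub ht0]
  simp only [Nat.factorial]
  push_cast
  field_simp

lemma continuousAt_iteratedDeriv_negLogDerivZetaSubZeta (n : ℕ) {s : ℂ} (hs : 1 ≤ s.re) :
    ContinuousAt (iteratedDeriv n negLogDerivZetaSubZeta) s := by
  rw [iteratedDeriv_eq_iterate]
  exact ((analyticAt_negLogDerivZetaSubZeta (zetaMulSubOne_ne_zero hs)).iterated_deriv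
    n).continuousAt

lemma exists_norm_iteratedDeriv_negLogDerivZetaSubZeta_le :
    ∃ C : ℝ, 0 ≤ C ∧ ∀ s : ℂ, 1 ≤ s.re → s.re ≤ 3 / 2 →
      ‖iteratedDeriv 4 negLogDerivZetaSubZeta s‖ ≤ C * (1 + |s.im|) ^ (1 / 2 : ℝ) := by
  obtain ⟨C, hC, h⟩ := exists_norm_iteratedDeriv_le_of_three_le_abs_im
  have hK : IsCompact (Set.Icc (1 : ℝ) (3 / 2) ×ℂ Set.Icc (-3 : ℝ) 3) :=
    isCompact_Icc.reProdIm isCompact_Icc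
  obtain ⟨D, hD⟩ := hK.exists_bound_of_continuousOn
    (f := iteratedDeriv 4 negLogDerivZetaSubZeta) (fun z hz =>
      (continuousAt_iteratedDeriv_negLogDerivZetaSubZeta 4 hz.1.1).continuousWithinAt)
  refine ⟨C + |D|, by positivity, fun s h1 h2 => ?_⟩
  have hpos : 1 ≤ (1 + |s.im|) ^ (1 / 2 : ℝ) :=
    Real.one_le_rpow (by linarith [abs_nonneg s.im]) (by norm_num)
  have hm : |s.im| ^ (1 / 2 : ℝ) ≤ (1 + |s.im|) ^ (1 / 2 : ℝ) :=
    Real.rpow_le_rpow (abs_nonneg _) (by linarith) (by norm_num)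
  rcases le_total 3 |s.im| with h3 | h3
  · have := h s h1 h2 h3
    nlinarith [abs_nonneg D]
  · have := hD s ⟨⟨h1, h2⟩, abs_le.mp h3⟩
    nlinarith [le_abs_self D, abs_nonneg D]

/-- The triangular cut-off `max (1 - v) 0` on `v > 0`, written with indicator functions. -/
noncomputable def triangleCutoff (v : ℝ) : ℂ :=
  (Set.Ioc (0 : ℝ) 1).indicator (fun _ => 1) v -
    (Set.Ioc (0 : ℝ) 1).indicator (fun t : ℝ => (t : ℂ) ^ (1 : ℂ)) v

lemma triangleCutoff_eq {v : ℝ} (hv : 0 < v) : triangleCutoff v = ((max (1 - v) 0 : ℝ) : ℂ) := by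
  by_cases h : v ≤ 1
  · have hm : v ∈ Set.Ioc (0 : ℝ) 1 := ⟨hv, h⟩
    rw [max_eq_left (by linarith)]
    simp [triangleCutoff, hm]
  · have hm : v ∉ Set.Ioc (0 : ℝ) 1 := fun h' => h h'.2
    rw [max_eq_right (by linarith)]
    simp [triangleCutoff, hm]

lemma continuousAt_triangleCutoff {v : ℝ} (hv : 0 < v) : ContinuousAt triangleCutoff v := by
  have : (fun v : ℝ => ((max (1 - v) 0 : ℝ) : ℂ)) =ᶠ[nhds v] triangleCutoff := by
    filter_upwards [lt_mem_nhds hv] with w hw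
    exact (triangleCutoff_eq hw).symm
  refine ContinuousAt.congr ?_ this
  fun_prop

lemma hasMellin_triangleCutoff {s : ℂ} (hs : 0 < s.re) :
    HasMellin triangleCutoff s (1 / s - 1 / (s + 1)) := by
  have h1 := hasMellin_one_Ioc hs
  have h2 := hasMellin_cpow_Ioc 1 (s := s) (by simp; linarith)
  have := hasMellin_sub h1.1 h2.1
  rw [h1.2, h2.2] at this
  exact this

lemma norm_one_div_sub_one_div_le {σ : ℝ} (hσ : 1 ≤ σ) (y : ℝ) :
    ‖1 / ((σ : ℂ) + y * Complex.I) - 1 / ((σ : ℂ) + y * Complex.I + 1)‖ ≤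
      4 * (1 + ‖y‖) ^ (-2 : ℝ) := by
  obtain ⟨s, hs⟩ : ∃ s : ℂ, s = (σ : ℂ) + y * Complex.I := ⟨_, rfl⟩
  have hre : s.re = σ := by rw [hs]; simp
  have him : s.im = y := by rw [hs]; simp
  rw [← hs]
  have h1 : (1 + |y|) / 2 ≤ ‖s‖ := by
    have := Complex.abs_re_le_norm s
    have := Complex.abs_im_le_norm s
    rw [hre] at *
    rw [him] at *
    have := le_abs_self σ
    linarith
  have h2 : (1 + |y|) / 2 ≤ ‖s + 1‖ := by
    have h3 := Complex.abs_re_le_norm (s + 1)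
    have h4 := Complex.abs_im_le_norm (s + 1)
    simp only [Complex.add_re, Complex.add_im, Complex.one_re, Complex.one_im, hre, him,
      add_zero] at h3 h4
    have := le_abs_self (σ + 1)
    linarith
  have hy : 0 < 1 + |y| := by positivity
  have s0 : s ≠ 0 := by rw [← norm_pos_iff]; linarith
  have s1 : s + 1 ≠ 0 := by rw [← norm_pos_iff]; linarith
  rw [show 1 / s - 1 / (s + 1) = 1 / (s * (s + 1)) by field_simp; ring, norm_div, norm_one,
    norm_mul, Real.norm_eq_abs, Real.rpow_neg hy.le, ← div_eq_mul_inv,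
    div_le_div_iff₀ (by positivity) (by positivity)]
  have := mul_le_mul h1 h2 (by positivity) (by positivity)
  norm_cast
  nlinarith

lemma integrable_one_div_sub_one_div {σ : ℝ} (hσ : 1 ≤ σ) :
    MeasureTheory.Integrable (fun y : ℝ =>
      1 / ((σ : ℂ) + y * Complex.I) - 1 / ((σ : ℂ) + y * Complex.I + 1)) := by
  have h := (integrable_one_add_norm (E := ℝ) (μ := MeasureTheory.volume) (r := 2)
    (by simp)).const_mul 4
  refine h.mono' ?_ (Filter.Eventually.of_forall (norm_one_div_sub_one_div_le hσ))
  have h1 : ∀ y : ℝ, (σ : ℂ) + y * Complex.I ≠ 0 := by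
    intro y hy
    have := congrArg Complex.re hy
    simp at this
    linarith
  have h2 : ∀ y : ℝ, (σ : ℂ) + y * Complex.I + 1 ≠ 0 := by
    intro y hy
    have := congrArg Complex.re hy
    simp at this
    linarith
  apply Continuous.aestronglyMeasurable
  exact (continuous_const.div (by fun_prop) h1).sub (continuous_const.div (by fun_prop) h2)

lemma triangleCutoff_eq_integral {σ v : ℝ} (hσ : 1 ≤ σ) (hv : 0 < v) :
    2 * Real.pi * triangleCutoff v = ∫ y : ℝ, (v : ℂ) ^ (-((σ : ℂ) + y * Complex.I)) *
      (1 / ((σ : ℂ) + y * Complex.I) - 1 / ((σ : ℂ) + y * Complex.I + 1)) := by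
  have hm : ∀ y : ℝ, mellin triangleCutoff ((σ : ℂ) + y * Complex.I) =
      1 / ((σ : ℂ) + y * Complex.I) - 1 / ((σ : ℂ) + y * Complex.I + 1) := fun y =>
    (hasMellin_triangleCutoff (by simp; linarith)).2
  have := mellinInv_mellin_eq σ triangleCutoff hv
    (hasMellin_triangleCutoff (by simp; linarith)).1 (by
      unfold Complex.VerticalIntegrable
      simp_rw [hm]
      exact integrable_one_div_sub_one_div hσ) (continuousAt_triangleCutoff hv)
  rw [← this, mellinInv]
  simp_rw [hm, smul_eq_mul, Complex.real_smul]
  rw [← mul_assoc]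
  push_cast
  rw [mul_one_div_cancel (by simp [Real.pi_ne_zero]), one_mul]

lemma norm_sum_mul_one_sub_div_le {a : ℕ → ℂ} {σ x B : ℝ} (hσ : 1 ≤ σ) (hx : 0 < x)
    (ha : LSeriesSummable a σ)
    (hB : ∀ y : ℝ, ‖LSeries a (σ + y * Complex.I)‖ ≤ B * (1 + |y|) ^ (1 / 2 : ℝ)) :
    ‖∑ n ∈ Finset.Icc 1 ⌊x⌋₊, a n * (1 - n / x)‖ ≤
      B * x ^ σ * (4 * ∫ y : ℝ, (1 + ‖y‖) ^ (-(3 / 2) : ℝ)) := by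
  have hB0 : 0 ≤ B := by
    have := hB 0
    simp only [abs_zero, add_zero, Real.one_rpow, mul_one] at this
    exact (norm_nonneg _).trans this
  obtain ⟨g, hg⟩ : ∃ g : ℝ → ℂ, g = fun y : ℝ =>
    1 / ((σ : ℂ) + y * Complex.I) - 1 / ((σ : ℂ) + y * Complex.I + 1) := ⟨_, rfl⟩
  have hgi : MeasureTheory.Integrable g := by rw [hg]; exact integrable_one_div_sub_one_div hσ
  have hgn : ∀ y, ‖g y‖ ≤ 4 * (1 + ‖y‖) ^ (-2 : ℝ) := by
    rw [hg]; exact norm_one_div_sub_one_div_le hσ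
  have hxn : ∀ y : ℝ, ‖(x : ℂ) ^ ((σ : ℂ) + y * Complex.I)‖ = x ^ σ := by
    intro y
    rw [Complex.norm_cpow_eq_rpow_re_of_pos hx]
    simp
  obtain ⟨F, hF⟩ : ∃ F : ℕ → ℝ → ℂ, F = fun n (y : ℝ) => LSeries.term a (σ + y * Complex.I) n *
    (x : ℂ) ^ ((σ : ℂ) + y * Complex.I) * g y := ⟨_, rfl⟩
  have hterm : ∀ n (y : ℝ), ‖LSeries.term a (σ + y * Complex.I) n‖ = ‖LSeries.term a σ n‖ := by
    intro n y
    simp [LSeries.norm_term_eq]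
  have hFn : ∀ n y, ‖F n y‖ = ‖LSeries.term a σ n‖ * x ^ σ * ‖g y‖ := by
    intro n y
    rw [hF]
    simp only [norm_mul, hterm, hxn]
  have hxc : (x : ℂ) ≠ 0 := by exact_mod_cast hx.ne'
  have hFi : ∀ n, MeasureTheory.Integrable (F n) := by
    intro n
    refine (hgi.norm.const_mul (‖LSeries.term a σ n‖ * x ^ σ)).mono' ?_
      (Filter.Eventually.of_forall fun y => (hFn n y).le)
    rw [hF]
    refine MeasureTheory.AEStronglyMeasurable.mul (Continuous.aestronglyMeasurable ?_)
      hgi.aestronglyMeasurable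
    refine Continuous.mul ?_ ?_
    · rcases eq_or_ne n 0 with rfl | hn
      · simpa using continuous_const
      · simp only [LSeries.term_of_ne_zero hn]
        have hn' : (n : ℂ) ≠ 0 := by exact_mod_cast hn
        refine continuous_const.div ?_ fun y => by simp [Complex.cpow_eq_zero_iff, hn]
        exact Continuous.const_cpow (by fun_prop) (Or.inl hn')
    · exact Continuous.const_cpow (by fun_prop) (Or.inl hxc)
  have hFs : Summable fun n => ∫ y, ‖F n y‖ := by
    simp_rw [hFn, MeasureTheory.integral_const_mul]
    exact ((summable_norm_iff.mpr ha).mul_right _).mul_right _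
  have hsum := MeasureTheory.hasSum_integral_of_summable_integral_norm hFi hFs
  have hint : ∀ n, ∫ y, F n y = 2 * Real.pi *
      (if n ∈ Finset.Icc 1 ⌊x⌋₊ then a n * (1 - n / x) else 0) := by
    intro n
    rcases eq_or_ne n 0 with rfl | hn
    · simp [hF]
    have hn0 : (0 : ℝ) < n := by exact_mod_cast Nat.pos_of_ne_zero hn
    have e : ∀ y, F n y = a n * ((((n / x : ℝ) : ℝ) : ℂ) ^ (-((σ : ℂ) + y * Complex.I)) * g y) := by
      intro y
      rw [hF]
      simp only [LSeries.term_of_ne_zero hn]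
      rw [div_eq_mul_inv (n : ℝ) x, Complex.ofReal_mul,
        Complex.mul_cpow_ofReal_nonneg hn0.le (by positivity), Complex.ofReal_inv,
        Complex.inv_cpow _ _ (by rw [Complex.arg_ofReal_of_nonneg hx.le]; exact Real.pi_pos.ne),
        Complex.cpow_neg, Complex.cpow_neg, inv_inv]
      push_cast
      ring
    simp_rw [e]
    rw [MeasureTheory.integral_const_mul, hg, ← triangleCutoff_eq_integral hσ (by positivity),
      triangleCutoff_eq (by positivity)]
    split_ifs with h
    · rw [Finset.mem_Icc, Nat.le_floor_iff hx.le] at h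
      rw [max_eq_left (by rw [sub_nonneg, div_le_one hx]; exact h.2)]
      push_cast
      ring
    · rw [Finset.mem_Icc, Nat.le_floor_iff hx.le] at h
      rw [max_eq_right]
      · simp
      · rw [sub_nonpos, one_le_div hx]
        by_contra h'
        exact h ⟨Nat.pos_of_ne_zero hn, by linarith⟩
  simp_rw [hint] at hsum
  have hfin : HasSum (fun n => 2 * (Real.pi : ℂ) *
      (if n ∈ Finset.Icc 1 ⌊x⌋₊ then a n * (1 - n / x) else 0))
      (2 * Real.pi * ∑ n ∈ Finset.Icc 1 ⌊x⌋₊, a n * (1 - n / x)) := by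
    have := hasSum_sum_of_ne_finset_zero (L := .unconditional ℕ) (f := fun n => 2 * (Real.pi : ℂ) *
      (if n ∈ Finset.Icc 1 ⌊x⌋₊ then a n * (1 - (n : ℂ) / x) else 0)) (s := Finset.Icc 1 ⌊x⌋₊)
      (fun b hb => by simp only [if_neg hb, mul_zero])
    convert this using 1
    rw [Finset.mul_sum]
    refine Finset.sum_congr rfl fun n hn => by simp only [if_pos hn]
  have heq := hfin.unique hsum
  have hle : ‖2 * (Real.pi : ℂ) * ∑ n ∈ Finset.Icc 1 ⌊x⌋₊, a n * (1 - n / x)‖ ≤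
      B * x ^ σ * (4 * ∫ y : ℝ, (1 + ‖y‖) ^ (-(3 / 2) : ℝ)) := by
    rw [heq, ← mul_assoc, ← MeasureTheory.integral_const_mul]
    refine MeasureTheory.norm_integral_le_of_norm_le
      ((integrable_one_add_norm (E := ℝ) (r := 3 / 2) (by norm_num)).const_mul _)
      (Filter.Eventually.of_forall fun y => ?_)
    have : ∑' n, F n y = LSeries a (σ + y * Complex.I) *
        (x : ℂ) ^ ((σ : ℂ) + y * Complex.I) * g y := by
      rw [hF, LSeries, ← tsum_mul_right, ← tsum_mul_right]
    rw [this, norm_mul, norm_mul, hxn]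
    have hy : 0 < 1 + |y| := by positivity
    calc _ ≤ B * (1 + |y|) ^ (1 / 2 : ℝ) * x ^ σ * (4 * (1 + ‖y‖) ^ (-2 : ℝ)) := by
          gcongr
          · exact hB y
          · exact hgn y
      _ = B * x ^ σ * 4 * ((1 + |y|) ^ (1 / 2 : ℝ) * (1 + |y|) ^ (-2 : ℝ)) := by
          rw [Real.norm_eq_abs]; ring
      _ = _ := by rw [← Real.rpow_add hy, Real.norm_eq_abs]; norm_num
  refine le_trans ?_ hle
  rw [norm_mul]
  refine le_mul_of_one_le_left (norm_nonneg _) ?_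
  rw [norm_mul, Complex.norm_real, Real.norm_of_nonneg Real.pi_pos.le]
  simp
  linarith [Real.pi_gt_three]

open ArithmeticFunction in
lemma LSeries_vonMangoldt_sub_one_eq {s : ℂ} (hs : 1 < s.re) :
    LSeries ((fun n => (vonMangoldt n : ℂ)) - 1) s = negLogDerivZetaSubZeta s := by
  rw [LSeries_sub (LSeriesSummable_vonMangoldt hs) (LSeriesSummable_one_iff.mpr hs),
    LSeries_vonMangoldt_eq_deriv_riemannZeta_div hs, LSeries_one_eq_riemannZeta hs,
    negLogDerivZetaSubZeta_eq (by rintro rfl; simp at hs)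
      (riemannZeta_ne_zero_of_one_le_re hs.le)]

open ArithmeticFunction in
lemma abscissaOfAbsConv_vonMangoldt_sub_one_le :
    LSeries.abscissaOfAbsConv ((fun n => (vonMangoldt n : ℂ)) - 1) ≤ (1 : ℝ) := by
  refine LSeries.abscissaOfAbsConv_le_of_forall_lt_LSeriesSummable fun y hy => ?_
  have hy' : 1 < (y : ℂ).re := by simpa using hy
  exact (LSeriesSummable_vonMangoldt hy').sub (LSeriesSummable_one_iff.mpr hy')

open ArithmeticFunction in
lemma exists_abs_sum_vonMangoldt_sub_one_mul_one_sub_div_le :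
    ∃ C : ℝ, 0 ≤ C ∧ ∀ x : ℝ, 8 ≤ x →
      |∑ n ∈ Finset.Icc 1 ⌊x⌋₊, (vonMangoldt n - 1) * Real.log n ^ 4 * (1 - n / x)| ≤ C * x := by
  obtain ⟨C, hC, hF⟩ := exists_norm_iteratedDeriv_negLogDerivZetaSubZeta_le
  have hI : 0 ≤ ∫ y : ℝ, (1 + ‖y‖) ^ (-(3 / 2) : ℝ) :=
    MeasureTheory.integral_nonneg fun y => by positivity
  obtain ⟨b, hb⟩ : ∃ b : ℕ → ℂ, b = (fun n => (vonMangoldt n : ℂ)) - 1 := ⟨_, rfl⟩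
  have hab : LSeries.abscissaOfAbsConv b ≤ (1 : ℝ) := by
    rw [hb]; exact abscissaOfAbsConv_vonMangoldt_sub_one_le
  refine ⟨C * Real.exp 1 * (4 * ∫ y : ℝ, (1 + ‖y‖) ^ (-(3 / 2) : ℝ)), by positivity, ?_⟩
  intro x hx
  have hx0 : 0 < x := by linarith
  have hlog : 2 ≤ Real.log x := by
    have h1 : Real.log 8 ≤ Real.log x := Real.log_le_log (by norm_num) hx
    have h2 : Real.log 8 = 3 * Real.log 2 := by
      rw [show (8 : ℝ) = 2 ^ 3 by norm_num, Real.log_pow]; norm_num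
    linarith [Real.log_two_gt_d9]
  obtain ⟨σ, hσ⟩ : ∃ σ, σ = 1 + 1 / Real.log x := ⟨_, rfl⟩
  have hσ1 : 1 < σ := by rw [hσ]; have : 0 < 1 / Real.log x := by positivity
                         linarith
  have hσ2 : σ ≤ 3 / 2 := by
    have : 1 / Real.log x ≤ 1 / 2 := one_div_le_one_div_of_le (by norm_num) hlog
    linarith
  have hxσ : x ^ σ = x * Real.exp 1 := by
    rw [hσ, Real.rpow_add hx0, Real.rpow_one, Real.rpow_def_of_pos hx0, mul_one_div_cancel]
    linarith
  have habs : ∀ y : ℝ, LSeries.abscissaOfAbsConv b < (((σ : ℂ) + y * Complex.I).re : ℝ) := by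
    intro y
    refine hab.trans_lt ?_
    simpa using by exact_mod_cast hσ1
  have hsum : LSeriesSummable (LSeries.logMul^[4] b) (σ : ℂ) := by
    refine LSeriesSummable_of_abscissaOfAbsConv_lt_re ?_
    rw [LSeries.absicssaOfAbsConv_logPowMul]
    simpa using habs 0
  have hbound : ∀ y : ℝ, ‖LSeries (LSeries.logMul^[4] b) (σ + y * Complex.I)‖ ≤
      C * (1 + |y|) ^ (1 / 2 : ℝ) := by
    intro y
    have h1 := LSeries_iteratedDeriv 4 (habs y)
    have h2 : LSeries b =ᶠ[nhds ((σ : ℂ) + y * Complex.I)] negLogDerivZetaSubZeta := by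
      have : IsOpen {s : ℂ | 1 < s.re} := isOpen_lt continuous_const Complex.continuous_re
      filter_upwards [this.mem_nhds (x := (σ : ℂ) + y * Complex.I) (by simpa using hσ1)] with s hs
      rw [hb]
      exact LSeries_vonMangoldt_sub_one_eq hs
    rw [h2.iteratedDeriv_eq] at h1
    have h3 := hF (σ + y * Complex.I) (by simpa using hσ1.le) (by simpa using hσ2)
    rw [h1] at h3
    simpa using h3
  have key := norm_sum_mul_one_sub_div_le hσ1.le hx0 hsum hbound
  have e : ∑ n ∈ Finset.Icc 1 ⌊x⌋₊, (LSeries.logMul^[4] b) n * (1 - n / x) =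
      ((∑ n ∈ Finset.Icc 1 ⌊x⌋₊, (vonMangoldt n - 1) * Real.log n ^ 4 * (1 - n / x) : ℝ) : ℂ) := by
    push_cast
    refine Finset.sum_congr rfl fun n _ => ?_
    have : (LSeries.logMul^[4] b) n = ((vonMangoldt n : ℂ) - 1) * Complex.log n ^ 4 := by
      simp only [Function.iterate_succ, Function.comp_apply, Function.iterate_zero, id_eq,
        LSeries.logMul, hb, Pi.sub_apply, Pi.one_apply]
      ring
    rw [this, ← Complex.natCast_log]
  rw [e, Complex.norm_real, Real.norm_eq_abs, hxσ] at key
  calc _ ≤ _ := key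
    _ = _ := by ring

/-- Differences of `∑ w n (x - n)` are controlled by the partial sums of `w`. -/
lemma sum_mul_sub_le_sub {w : ℕ → ℝ} (hw : ∀ n, 0 ≤ w n) {x y : ℝ} (hx : 0 ≤ x) (hxy : x ≤ y) :
    (∑ n ∈ Finset.Icc 1 ⌊x⌋₊, w n) * (y - x) ≤
      ∑ n ∈ Finset.Icc 1 ⌊y⌋₊, w n * (y - n) - ∑ n ∈ Finset.Icc 1 ⌊x⌋₊, w n * (x - n) ∧
    ∑ n ∈ Finset.Icc 1 ⌊y⌋₊, w n * (y - n) - ∑ n ∈ Finset.Icc 1 ⌊x⌋₊, w n * (x - n) ≤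
      (∑ n ∈ Finset.Icc 1 ⌊y⌋₊, w n) * (y - x) := by
  have hsub : Finset.Icc 1 ⌊x⌋₊ ⊆ Finset.Icc 1 ⌊y⌋₊ :=
    Finset.Icc_subset_Icc_right (Nat.floor_le_floor hxy)
  have hlt : ∀ n ∈ Finset.Icc 1 ⌊y⌋₊ \ Finset.Icc 1 ⌊x⌋₊, x ≤ n ∧ (n : ℝ) ≤ y := by
    intro n hn
    rw [Finset.mem_sdiff, Finset.mem_Icc, Finset.mem_Icc, Nat.le_floor_iff hx,
      Nat.le_floor_iff (hx.trans hxy)] at hn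
    exact ⟨le_of_not_ge fun h => hn.2 ⟨hn.1.1, h⟩, hn.1.2⟩
  have e : ∑ n ∈ Finset.Icc 1 ⌊y⌋₊, w n * (y - n) - ∑ n ∈ Finset.Icc 1 ⌊x⌋₊, w n * (x - n) =
      (∑ n ∈ Finset.Icc 1 ⌊x⌋₊, w n) * (y - x) +
      ∑ n ∈ Finset.Icc 1 ⌊y⌋₊ \ Finset.Icc 1 ⌊x⌋₊, w n * (y - n) := by
    rw [← Finset.sum_sdiff hsub, Finset.sum_mul, add_sub_assoc, ← Finset.sum_sub_distrib, add_comm]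
    congr 1
    exact Finset.sum_congr rfl fun n _ => by ring
  rw [e]
  constructor
  · have := Finset.sum_nonneg fun n hn => mul_nonneg (hw n) (sub_nonneg.mpr (hlt n hn).2)
    linarith
  · have := Finset.sum_le_sum fun n hn =>
      mul_le_mul_of_nonneg_left (a := w n) (sub_le_sub_left (hlt n hn).1 y) (hw n)
    rw [← Finset.sum_mul] at this
    rw [← Finset.sum_sdiff hsub (f := w), add_mul]
    linarith

lemma sum_log_pow_four_sub_le {x y : ℝ} (hx : 0 ≤ x) (hxy : x ≤ y) :
    ∑ n ∈ Finset.Icc 1 ⌊y⌋₊, Real.log n ^ 4 - ∑ n ∈ Finset.Icc 1 ⌊x⌋₊, Real.log n ^ 4 ≤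
      (y - x + 1) * Real.log y ^ 4 := by
  have hle := Nat.floor_le_floor hxy
  have hsub : Finset.Icc 1 ⌊x⌋₊ ⊆ Finset.Icc 1 ⌊y⌋₊ := Finset.Icc_subset_Icc_right hle
  rw [← Finset.sum_sdiff hsub, add_sub_cancel_right]
  have h1 : ∀ n ∈ Finset.Icc 1 ⌊y⌋₊ \ Finset.Icc 1 ⌊x⌋₊, Real.log n ^ 4 ≤ Real.log y ^ 4 := by
    intro n hn
    rw [Finset.mem_sdiff, Finset.mem_Icc, Nat.le_floor_iff (hx.trans hxy)] at hn
    have : (1 : ℝ) ≤ n := by exact_mod_cast hn.1.1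
    have := Real.log_nonneg this
    gcongr
    exact hn.1.2
  refine (Finset.sum_le_card_nsmul _ _ _ h1).trans ?_
  rw [nsmul_eq_mul]
  gcongr
  rw [Finset.card_sdiff_of_subset hsub, Nat.card_Icc, Nat.card_Icc, Nat.add_sub_cancel,
    Nat.add_sub_cancel, Nat.cast_sub hle]
  have := Nat.floor_le (hx.trans hxy)
  have := Nat.lt_floor_add_one x
  linarith

open ArithmeticFunction in
lemma exists_abs_sum_vonMangoldt_sub_one_mul_log_pow_four_le :
    ∃ C : ℝ, 0 ≤ C ∧ ∀ x : ℝ, 64 ≤ x →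
      |∑ n ∈ Finset.Icc 1 ⌊x⌋₊, (vonMangoldt n - 1) * Real.log n ^ 4| ≤
        C * (x * Real.log x ^ 2) := by
  obtain ⟨C, hC, hE⟩ := exists_abs_sum_vonMangoldt_sub_one_mul_one_sub_div_le
  obtain ⟨A, hA⟩ : ∃ A : ℝ → ℝ, A = fun x => ∑ n ∈ Finset.Icc 1 ⌊x⌋₊,
    vonMangoldt n * Real.log n ^ 4 := ⟨_, rfl⟩
  obtain ⟨N, hN⟩ : ∃ N : ℝ → ℝ, N = fun x => ∑ n ∈ Finset.Icc 1 ⌊x⌋₊,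
    Real.log n ^ 4 := ⟨_, rfl⟩
  obtain ⟨GA, hGA⟩ : ∃ G : ℝ → ℝ, G = fun x => ∑ n ∈ Finset.Icc 1 ⌊x⌋₊,
    vonMangoldt n * Real.log n ^ 4 * (x - n) := ⟨_, rfl⟩
  obtain ⟨GN, hGN⟩ : ∃ G : ℝ → ℝ, G = fun x => ∑ n ∈ Finset.Icc 1 ⌊x⌋₊,
    Real.log n ^ 4 * (x - n) := ⟨_, rfl⟩
  have hG : ∀ x, 8 ≤ x → |GA x - GN x| ≤ C * x ^ 2 := by
    intro x hx
    have hx0 : 0 < x := by linarith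
    have e : GA x - GN x = x *
        ∑ n ∈ Finset.Icc 1 ⌊x⌋₊, (vonMangoldt n - 1) * Real.log n ^ 4 * (1 - n / x) := by
      rw [hGA, hGN, ← Finset.sum_sub_distrib, Finset.mul_sum]
      refine Finset.sum_congr rfl fun n _ => ?_
      field_simp
    rw [e, abs_mul, abs_of_pos hx0]
    nlinarith [hE x hx]
  have hdA : ∀ x y : ℝ, 0 ≤ x → x ≤ y → A x * (y - x) ≤ GA y - GA x ∧
      GA y - GA x ≤ A y * (y - x) := by
    intro x y hx hxy
    rw [hA, hGA]
    exact sum_mul_sub_le_sub (fun n => mul_nonneg vonMangoldt_nonneg (by positivity)) hx hxy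
  have hdN : ∀ x y : ℝ, 0 ≤ x → x ≤ y → N x * (y - x) ≤ GN y - GN x ∧
      GN y - GN x ≤ N y * (y - x) := by
    intro x y hx hxy
    rw [hN, hGN]
    exact sum_mul_sub_le_sub (fun n => by positivity) hx hxy
  have hNN : ∀ x y : ℝ, 0 ≤ x → x ≤ y → N y - N x ≤ (y - x + 1) * Real.log y ^ 4 := by
    intro x y hx hxy
    rw [hN]
    exact sum_log_pow_four_sub_le hx hxy
  refine ⟨80 + 5 * C, by positivity, fun x hx => ?_⟩
  have hx0 : 0 < x := by linarith
  have e : ∑ n ∈ Finset.Icc 1 ⌊x⌋₊, (vonMangoldt n - 1) * Real.log n ^ 4 = A x - N x := by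
    rw [hA, hN, ← Finset.sum_sub_distrib]
    exact Finset.sum_congr rfl fun n _ => by ring
  rw [e]
  obtain ⟨L, hL⟩ : ∃ L, L = Real.log x := ⟨_, rfl⟩
  have hL2 : 2 ≤ L := by
    have h1 : Real.log 64 ≤ Real.log x := Real.log_le_log (by norm_num) hx
    have h2 : Real.log 64 = 6 * Real.log 2 := by
      rw [show (64 : ℝ) = 2 ^ 6 by norm_num, Real.log_pow]; norm_num
    linarith [Real.log_two_gt_d9]
  have hLx : L ^ 2 ≤ 4 * x := by
    have h1 := Real.log_le_sub_one_of_pos (Real.sqrt_pos.mpr hx0)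
    rw [Real.log_sqrt hx0.le, ← hL] at h1
    have h2 : L ≤ 2 * √x := by linarith
    calc L ^ 2 ≤ (2 * √x) ^ 2 := by gcongr
      _ = 4 * x := by rw [mul_pow, Real.sq_sqrt hx0.le]; norm_num
  obtain ⟨h, hh⟩ : ∃ h, h = x / L ^ 2 := ⟨_, rfl⟩
  have hhx : h * L ^ 2 = x := by rw [hh]; field_simp
  have hh0 : 0 < h := by rw [hh]; positivity
  have hh1 : 1 ≤ 4 * h := by
    rw [hh]; rw [← mul_div_assoc, one_le_div (by positivity)]; exact hLx
  have hh2 : h ≤ x / 4 := by rw [hh]; gcongr; nlinarith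
  have l1 : Real.log (x + h) ^ 4 ≤ 16 * L ^ 4 := by
    have : Real.log (x + h) ≤ 2 * L := by
      rw [hL, show 2 * Real.log x = Real.log (x ^ 2) by rw [Real.log_pow]; norm_num]
      exact Real.log_le_log (by linarith) (by nlinarith)
    have h0 : 0 ≤ Real.log (x + h) := Real.log_nonneg (by linarith)
    calc Real.log (x + h) ^ 4 ≤ (2 * L) ^ 4 := by gcongr
      _ = _ := by ring
  have hmain : (h + 1) * (16 * L ^ 4) ≤ 80 * (x * L ^ 2) := by
    calc (h + 1) * (16 * L ^ 4) ≤ (5 * h) * (16 * L ^ 4) := by gcongr; linarith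
      _ = 80 * ((h * L ^ 2) * L ^ 2) := by ring
      _ = _ := by rw [hhx]
  have hx2 : x ^ 2 = (x * L ^ 2) * h := by rw [← hhx]; ring
  rw [← hL, abs_le]
  have g0 := abs_le.mp (hG x (by linarith))
  constructor
  · have a1 := (hdA (x - h) x (by linarith) (by linarith)).2
    have a2 := (hdN (x - h) x (by linarith) (by linarith)).1
    have a3 := hNN (x - h) x (by linarith) (by linarith)
    have g1 := abs_le.mp (hG (x - h) (by linarith))
    rw [← hL, sub_sub_cancel] at a3
    rw [sub_sub_cancel] at a1 a2
    have a4 : (h + 1) * L ^ 4 ≤ 80 * (x * L ^ 2) := hmain.trans' (by gcongr; nlinarith [pow_pos (by linarith : 0 < L) 4])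
    have g2 : C * (x - h) ^ 2 ≤ C * x ^ 2 := by gcongr <;> linarith
    have : (N x - A x) * h ≤ ((80 + 5 * C) * (x * L ^ 2)) * h := by
      have : (80 + 5 * C) * (x * L ^ 2) * h = 80 * (x * L ^ 2) * h + 5 * (C * x ^ 2) := by
        rw [hx2]; ring
      rw [this]
      have : (N x - N (x - h)) * h ≤ 80 * (x * L ^ 2) * h := by gcongr; linarith
      have : 0 ≤ C * x ^ 2 := by positivity
      linarith
    linarith [le_of_mul_le_mul_right this hh0]
  · have a1 := (hdA x (x + h) (by linarith) (by linarith)).1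
    have a2 := (hdN x (x + h) (by linarith) (by linarith)).2
    have a3 := hNN x (x + h) (by linarith) (by linarith)
    have g1 := abs_le.mp (hG (x + h) (by linarith))
    rw [add_sub_cancel_left] at a1 a2 a3
    have a4 : (h + 1) * Real.log (x + h) ^ 4 ≤ 80 * (x * L ^ 2) := hmain.trans' (by gcongr)
    have g2 : C * (x + h) ^ 2 ≤ C * (4 * x ^ 2) := by gcongr; nlinarith
    have : (A x - N x) * h ≤ ((80 + 5 * C) * (x * L ^ 2)) * h := by
      have : (80 + 5 * C) * (x * L ^ 2) * h = 80 * (x * L ^ 2) * h + 5 * (C * x ^ 2) := by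
        rw [hx2]; ring
      rw [this]
      have : (N (x + h) - N x) * h ≤ 80 * (x * L ^ 2) * h := by gcongr; linarith
      linarith
    exact le_of_mul_le_mul_right this hh0

lemma one_add_log_le_mul {t y : ℝ} (ht : 1 ≤ t) (hty : t ≤ y) :
    1 + Real.log y ≤ (1 + Real.log t) * (1 + Real.log (y / t)) := by
  have h1 := Real.log_nonneg ht
  have h2 : 0 ≤ Real.log (y / t) := Real.log_nonneg ((one_le_div (by linarith)).mpr hty)
  have h3 : Real.log y = Real.log t + Real.log (y / t) := by
    rw [← Real.log_mul (by linarith) (div_pos (by linarith) (by linarith)).ne', mul_div_cancel₀ _ (by linarith)]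
  rw [h3]
  nlinarith

lemma exists_one_add_log_pow_le (m : ℕ) {ε : ℝ} (hε : 0 < ε) :
    ∃ C : ℝ, 0 < C ∧ ∀ r : ℝ, 1 ≤ r → (1 + Real.log r) ^ m ≤ C * r ^ ε := by
  obtain ⟨δ, hδ⟩ : ∃ δ, δ = ε / (m + 1) := ⟨_, rfl⟩
  have hδ0 : 0 < δ := by rw [hδ]; positivity
  refine ⟨(1 + 1 / δ) ^ m, by positivity, fun r hr => ?_⟩
  have h0 := Real.log_nonneg hr
  have h1 : 1 + Real.log r ≤ (1 + 1 / δ) * r ^ δ := by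
    have := Real.log_le_rpow_div (by linarith : 0 ≤ r) hδ0
    have := Real.one_le_rpow hr hδ0.le
    rw [add_mul, one_mul, one_div_mul_eq_div]
    linarith
  calc (1 + Real.log r) ^ m ≤ ((1 + 1 / δ) * r ^ δ) ^ m := by gcongr
    _ = (1 + 1 / δ) ^ m * r ^ (δ * m) := by
      rw [mul_pow, ← Real.rpow_natCast (r ^ δ), ← Real.rpow_mul (by linarith)]
    _ ≤ _ := by
      gcongr
      · rw [hδ, div_mul_eq_mul_div, div_le_iff₀ (by positivity)]
        nlinarith

/-- Negative powers of `1 + log t` vary slowly. -/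
lemma exists_inv_one_add_log_pow_le (m : ℕ) {ε : ℝ} (hε : 0 < ε) :
    ∃ C : ℝ, 0 < C ∧ ∀ t y : ℝ, 1 ≤ t → t ≤ y →
      ((1 + Real.log t) ^ m)⁻¹ ≤ C * (y / t) ^ ε * ((1 + Real.log y) ^ m)⁻¹ := by
  obtain ⟨C, hC, h⟩ := exists_one_add_log_pow_le m hε
  refine ⟨C, hC, fun t y ht hty => ?_⟩
  have h1 := Real.log_nonneg ht
  have h2 := Real.log_nonneg (ht.trans hty)
  have hr : 1 ≤ y / t := (one_le_div (by linarith)).mpr hty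
  rw [← div_eq_mul_inv, le_div_iff₀ (by positivity), inv_mul_le_iff₀ (by positivity)]
  calc (1 + Real.log y) ^ m ≤ ((1 + Real.log t) * (1 + Real.log (y / t))) ^ m := by
        gcongr; exact one_add_log_le_mul ht hty
    _ = (1 + Real.log t) ^ m * (1 + Real.log (y / t)) ^ m := mul_pow _ _ _
    _ ≤ _ := by gcongr; exact h _ hr

open MeasureTheory in
/-- Abel summation against a sequence whose partial sums are close to a linear function. -/
lemma abs_sum_mul_sub_integral_le {c : ℕ → ℝ} {f f' H : ℝ → ℝ} {a b κ : ℝ} (ha : 0 ≤ a)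
    (hab : a ≤ b) (hf : ∀ t ∈ Set.Icc a b, HasDerivAt f (f' t) t)
    (hf' : ContinuousOn f' (Set.Icc a b)) (hH : IntervalIntegrable H volume a b)
    (hc : ∀ t ∈ Set.Icc a b, |f' t| * |∑ k ∈ Finset.Icc 0 ⌊t⌋₊, c k - κ * t| ≤ H t) :
    |∑ k ∈ Finset.Ioc ⌊a⌋₊ ⌊b⌋₊, f k * c k - κ * ∫ t in a..b, f t| ≤
      |f b| * |∑ k ∈ Finset.Icc 0 ⌊b⌋₊, c k - κ * b| +
      |f a| * |∑ k ∈ Finset.Icc 0 ⌊a⌋₊, c k - κ * a| + ∫ t in a..b, H t := by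
  obtain ⟨S, hS⟩ : ∃ S : ℝ → ℝ, S = fun t => ∑ k ∈ Finset.Icc 0 ⌊t⌋₊, c k := ⟨_, rfl⟩
  have hSt : ∀ t, ∑ k ∈ Finset.Icc 0 ⌊t⌋₊, c k = S t := fun t => by rw [hS]
  have hcf : ContinuousOn f (Set.Icc a b) := fun t ht =>
    (hf t ht).continuousAt.continuousWithinAt
  have hdi : IntegrableOn f' (Set.Icc a b) := hf'.integrableOn_Icc
  have hder : ∀ t ∈ Set.Icc a b, deriv f t = f' t := fun t ht => (hf t ht).deriv
  have hdi' : IntegrableOn (deriv f) (Set.Icc a b) :=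
    hdi.congr_fun (fun t ht => (hder t ht).symm) measurableSet_Icc
  have habel := sum_mul_eq_sub_sub_integral_mul c ha hab
    (fun t ht => (hf t ht).differentiableAt) hdi'
  have hint1 : IntervalIntegrable (fun t => f' t * S t) volume a b := by
    rw [intervalIntegrable_iff_integrableOn_Icc_of_le hab]
    simpa only [hSt] using integrableOn_mul_sum_Icc (m := 0) c ha hdi
  have hint2 : IntervalIntegrable (fun t => t * f' t) volume a b :=
    (continuousOn_id.mul hf').intervalIntegrable_of_Icc hab
  have hint3 : IntervalIntegrable f volume a b := hcf.intervalIntegrable_of_Icc hab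
  have e1 : ∫ t in Set.Ioc a b, deriv f t * ∑ k ∈ Finset.Icc 0 ⌊t⌋₊, c k =
      ∫ t in a..b, f' t * S t := by
    rw [intervalIntegral.integral_of_le hab]
    refine setIntegral_congr_fun measurableSet_Ioc fun t ht => ?_
    simp only [hder t ⟨ht.1.le, ht.2⟩, hSt]
  have e2 : ∫ t in a..b, (f t + t * f' t) = b * f b - a * f a := by
    refine intervalIntegral.integral_eq_sub_of_hasDerivAt (f := fun t => t * f t)
      (fun t ht => ?_) (hint3.add hint2)
    rw [Set.uIcc_of_le hab] at ht
    have := (hasDerivAt_id' t).fun_mul (hf t ht)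
    rwa [one_mul] at this
  rw [intervalIntegral.integral_add hint3 hint2] at e2
  have e3 : ∫ t in a..b, f' t * (S t - κ * t) =
      (∫ t in a..b, f' t * S t) - κ * ∫ t in a..b, t * f' t := by
    rw [← intervalIntegral.integral_const_mul,
      ← intervalIntegral.integral_sub hint1 (hint2.const_mul κ)]
    exact intervalIntegral.integral_congr fun t _ => by ring
  have e4 : ∑ k ∈ Finset.Ioc ⌊a⌋₊ ⌊b⌋₊, f k * c k - κ * ∫ t in a..b, f t =
      f b * (S b - κ * b) - f a * (S a - κ * a) - ∫ t in a..b, f' t * (S t - κ * t) := by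
    rw [habel, e1, e3, hSt, hSt]
    linear_combination (-κ) * e2
  have hle : |∫ t in a..b, f' t * (S t - κ * t)| ≤ ∫ t in a..b, H t := by
    rw [← Real.norm_eq_abs]
    refine intervalIntegral.norm_integral_le_of_norm_le hab
      (Filter.Eventually.of_forall fun t ht => ?_) hH
    rw [Real.norm_eq_abs, abs_mul, ← hSt]
    exact hc t ⟨ht.1.le, ht.2⟩
  rw [e4, hSt, hSt, ← abs_mul, ← abs_mul]
  exact (abs_sub _ _).trans (add_le_add (abs_sub _ _) hle)

lemma integral_rpow_le_of_neg_one_lt {a b s : ℝ} (ha : 0 < a) (hs : -1 < s) :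
    ∫ t in a..b, t ^ s ≤ b ^ (s + 1) / (s + 1) := by
  rw [integral_rpow (Or.inl hs)]
  have : 0 ≤ a ^ (s + 1) := by positivity
  gcongr
  · linarith
  · linarith

lemma integral_rpow_le_of_lt_neg_one {a b s : ℝ} (ha : 0 < a) (hab : a ≤ b) (hs : s < -1) :
    ∫ t in a..b, t ^ s ≤ a ^ (s + 1) / (-(s + 1)) := by
  rw [integral_rpow (Or.inr ⟨hs.ne, Set.notMem_uIcc_of_lt ha (ha.trans_le hab)⟩),
    ← neg_div_neg_eq]
  have : 0 ≤ b ^ (s + 1) := by have := ha.trans_le hab; positivity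
  gcongr
  · linarith
  · linarith

/-- Partial summation with weights `1 / log ^ j n`. -/
lemma exists_abs_sum_div_log_pow_sub_le {c : ℕ → ℝ} {κ K : ℝ} {A b j : ℕ} (hAj : A ≤ j)
    (hK : 0 ≤ K)
    (hc0 : c 0 = 0) (hc1 : c 1 = 0)
    (hc : ∀ t : ℝ, 2 ≤ t → |∑ k ∈ Finset.Icc 0 ⌊t⌋₊, c k - κ * t| ≤
      K * (t * (1 + Real.log t) ^ A * ((1 + Real.log t) ^ b)⁻¹)) :
    ∃ C : ℝ, 0 ≤ C ∧ ∀ x : ℝ, 2 ≤ x →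
      |∑ k ∈ Finset.Icc 0 ⌊x⌋₊, c k / Real.log k ^ j - κ * ∫ t in 2..x, (Real.log t ^ j)⁻¹| ≤
        C * (x * ((1 + Real.log x) ^ (b + j - A))⁻¹) := by
  obtain ⟨D, hD, hslow⟩ := exists_inv_one_add_log_pow_le (b + j - A) (ε := 1 / 2) (by norm_num)
  have hl2 := Real.log_two_gt_d9
  have hlb : ∀ t : ℝ, 2 ≤ t → (1 + Real.log t) / 3 ≤ Real.log t := fun t ht => by
    have := Real.log_le_log (by norm_num) ht
    linarith
  have hmono : ∀ x : ℝ, 2 ≤ x → 1 ≤ D * (x * ((1 + Real.log x) ^ (b + j - A))⁻¹) := by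
    intro x hx
    have h := hslow 1 x le_rfl (by linarith)
    simp only [Real.log_one, add_zero, one_pow, inv_one, div_one] at h
    have h2 : x ^ (1 / 2 : ℝ) ≤ x := by
      calc x ^ (1 / 2 : ℝ) ≤ x ^ (1 : ℝ) :=
            Real.rpow_le_rpow_of_exponent_le (by linarith) (by norm_num)
        _ = x := Real.rpow_one x
    have h3 : 0 ≤ Real.log x := Real.log_nonneg (by linarith)
    calc 1 ≤ _ := h
      _ = D * (x ^ (1 / 2 : ℝ) * ((1 + Real.log x) ^ (b + j - A))⁻¹) := by ring
      _ ≤ _ := by gcongr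
  obtain ⟨E₂, hE₂⟩ : ∃ E, E = |(Real.log 2 ^ j)⁻¹| * |∑ k ∈ Finset.Icc 0 ⌊(2 : ℝ)⌋₊, c k - κ * 2| +
      |c 2 / Real.log 2 ^ j| := ⟨_, rfl⟩
  have hE₂0 : 0 ≤ E₂ := by rw [hE₂]; positivity
  have hpt : ∀ (i : ℕ) (t : ℝ), 2 ≤ t → (Real.log t ^ i)⁻¹ ≤ 3 ^ i * ((1 + Real.log t) ^ i)⁻¹ := by
    intro i t ht
    have h1 := hlb t ht
    have h2 : 0 < Real.log t := Real.log_pos (by linarith)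
    calc (Real.log t ^ i)⁻¹ ≤ (((1 + Real.log t) / 3) ^ i)⁻¹ := by gcongr
      _ = _ := by rw [div_pow, inv_div, div_eq_mul_inv]
  have hexp : ∀ t : ℝ, 2 ≤ t → (1 + Real.log t) ^ A * ((1 + Real.log t) ^ b)⁻¹ *
      ((1 + Real.log t) ^ j)⁻¹ = ((1 + Real.log t) ^ (b + j - A))⁻¹ := by
    intro t ht
    have h2 : 0 < Real.log t := Real.log_pos (by linarith)
    have h3 : (1 + Real.log t) ^ b * (1 + Real.log t) ^ j =
        (1 + Real.log t) ^ A * (1 + Real.log t) ^ (b + j - A) := by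
      rw [← pow_add, ← pow_add]; congr 1; omega
    rw [mul_assoc, ← mul_inv, h3]
    field_simp
  refine ⟨3 ^ j * K + E₂ * D + (j * 3 ^ (j + 1) * K * D) * 4, by positivity, fun x hx => ?_⟩
  have hx0 : 0 < x := by linarith
  have hlx : 0 ≤ Real.log x := Real.log_nonneg (by linarith)
  obtain ⟨G, hG⟩ : ∃ G, G = ((1 + Real.log x) ^ (b + j - A))⁻¹ := ⟨_, rfl⟩
  have hG0 : 0 ≤ G := by rw [hG]; positivity
  have key := abs_sum_mul_sub_integral_le (c := c) (f := fun t => (Real.log t ^ j)⁻¹)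
    (f' := fun t => -((j : ℝ) * Real.log t ^ (j - 1) * t⁻¹) / (Real.log t ^ j) ^ 2)
    (H := fun t => (j * 3 ^ (j + 1) * K * D * x ^ (1 / 2 : ℝ) * G) * t ^ (-(1 / 2) : ℝ))
    (a := 2) (b := x) (κ := κ) (by norm_num) hx ?_ ?_ ?_ ?_
  · have hsplit : ∑ k ∈ Finset.Icc 0 ⌊x⌋₊, c k / Real.log k ^ j =
        c 2 / Real.log 2 ^ j + ∑ k ∈ Finset.Ioc ⌊(2 : ℝ)⌋₊ ⌊x⌋₊, (Real.log k ^ j)⁻¹ * c k := by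
      have h2x : 2 ≤ ⌊x⌋₊ := Nat.le_floor (by exact_mod_cast hx)
      rw [show ⌊(2 : ℝ)⌋₊ = 2 from Nat.floor_ofNat 2, Finset.Icc_eq_cons_Ioc (Nat.zero_le _),
        Finset.sum_cons, hc0, zero_div, zero_add, ← Finset.sum_Ioc_consecutive _ (by omega) h2x]
      congr 1
      · simp [Finset.sum_Ioc_succ_top, hc1]
      · exact Finset.sum_congr rfl fun k _ => by rw [div_eq_inv_mul]
    rw [hsplit]
    have hb1 : |(Real.log x ^ j)⁻¹| * |∑ k ∈ Finset.Icc 0 ⌊x⌋₊, c k - κ * x| ≤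
        3 ^ j * K * (x * G) := by
      have h2 : 0 < Real.log x := Real.log_pos (by linarith)
      rw [abs_of_nonneg (by positivity)]
      calc _ ≤ (3 ^ j * ((1 + Real.log x) ^ j)⁻¹) *
            (K * (x * (1 + Real.log x) ^ A * ((1 + Real.log x) ^ b)⁻¹)) :=
            mul_le_mul (hpt j x hx) (hc x hx) (abs_nonneg _) (by positivity)
        _ = 3 ^ j * K * (x * ((1 + Real.log x) ^ A * ((1 + Real.log x) ^ b)⁻¹ *
            ((1 + Real.log x) ^ j)⁻¹)) := by ring
        _ = _ := by rw [hexp x hx, hG]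
    have hb2 : E₂ ≤ E₂ * D * (x * G) := by
      have := hmono x hx
      rw [← hG] at this
      nlinarith
    have hb3 : ∫ t in (2 : ℝ)..x, (j * 3 ^ (j + 1) * K * D * x ^ (1 / 2 : ℝ) * G) * t ^ (-(1 / 2) : ℝ) ≤
        (j * 3 ^ (j + 1) * K * D) * 4 * (x * G) := by
      rw [intervalIntegral.integral_const_mul]
      have h1 := integral_rpow_le_of_neg_one_lt (a := 2) (b := x) (s := -(1 / 2)) (by norm_num)
        (by norm_num)
      have h2 : x ^ (1 / 2 : ℝ) * x ^ (1 / 2 : ℝ) = x := by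
        rw [← Real.rpow_add hx0]; norm_num
      calc _ ≤ (j * 3 ^ (j + 1) * K * D * x ^ (1 / 2 : ℝ) * G) *
            (x ^ (-(1 / 2) + 1 : ℝ) / (-(1 / 2) + 1)) := by gcongr
        _ = (j * 3 ^ (j + 1) * K * D) * 2 * ((x ^ (1 / 2 : ℝ) * x ^ (1 / 2 : ℝ)) * G) := by
            norm_num; ring
        _ ≤ _ := by
            rw [h2]
            have : 0 ≤ (j * 3 ^ (j + 1) * K * D) * (x * G) := by positivity
            linarith
    rw [hE₂] at hb2
    rw [← hE₂] at hb2
    have htri := abs_add_le (c 2 / Real.log 2 ^ j)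
      (∑ k ∈ Finset.Ioc ⌊(2 : ℝ)⌋₊ ⌊x⌋₊, (Real.log k ^ j)⁻¹ * c k -
        κ * ∫ t in (2 : ℝ)..x, (Real.log t ^ j)⁻¹)
    rw [← add_sub_assoc] at htri
    rw [← hG]
    linarith
  · intro t ht
    have h2 : 0 < Real.log t := Real.log_pos (by linarith [ht.1])
    exact ((Real.hasDerivAt_log (by linarith [ht.1])).fun_pow j).fun_inv (by positivity)
  · intro t ht
    have h2 : 0 < Real.log t := Real.log_pos (by linarith [ht.1])
    have h3 : t ≠ 0 := by linarith [ht.1]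
    have h4 : (Real.log t ^ j) ^ 2 ≠ 0 := by positivity
    apply ContinuousAt.continuousWithinAt
    fun_prop (disch := assumption)
  · exact (intervalIntegral.intervalIntegrable_rpow (Or.inr
      (Set.notMem_uIcc_of_lt (by norm_num) hx0))).const_mul _
  · intro t ht
    have ht1 := ht.1
    have ht0 : 0 < t := by linarith
    have h2 : 0 < Real.log t := Real.log_pos (by linarith)
    rcases Nat.eq_zero_or_pos j with rfl | hj
    · simp
    have e1 : |-((j : ℝ) * Real.log t ^ (j - 1) * t⁻¹) / (Real.log t ^ j) ^ 2| =
        j * t⁻¹ * (Real.log t ^ (j + 1))⁻¹ := by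
      rw [abs_div, abs_neg, abs_of_nonneg (by positivity), abs_of_nonneg (by positivity)]
      have : (Real.log t ^ j) ^ 2 = Real.log t ^ (j - 1) * Real.log t ^ (j + 1) := by
        rw [← pow_mul, ← pow_add]; congr 1; omega
      rw [this]
      field_simp
    have e2 : (Real.log t ^ (j + 1))⁻¹ ≤ 3 ^ (j + 1) * ((1 + Real.log t) ^ j)⁻¹ := by
      refine (hpt (j + 1) t ht1).trans ?_
      gcongr
      · linarith
      · omega
    rw [e1]
    calc _ ≤ j * t⁻¹ * (3 ^ (j + 1) * ((1 + Real.log t) ^ j)⁻¹) *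
          (K * (t * (1 + Real.log t) ^ A * ((1 + Real.log t) ^ b)⁻¹)) := by
          gcongr
          exact hc t ht1
      _ = j * 3 ^ (j + 1) * K * ((1 + Real.log t) ^ A * ((1 + Real.log t) ^ b)⁻¹ *
          ((1 + Real.log t) ^ j)⁻¹) := by field_simp
      _ ≤ j * 3 ^ (j + 1) * K * (D * (x / t) ^ (1 / 2 : ℝ) * G) := by
          rw [hexp t ht1, hG]
          gcongr
          exact hslow t x (by linarith) ht.2
      _ = _ := by
          rw [Real.div_rpow hx0.le ht0.le, Real.rpow_neg ht0.le]
          ring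

open ArithmeticFunction in
lemma exists_abs_psi_sub_le :
    ∃ K : ℝ, 0 ≤ K ∧ ∀ x : ℝ, 2 ≤ x →
      |Chebyshev.psi x - x| ≤ K * (x * ((1 + Real.log x) ^ 2)⁻¹) + 2 := by
  obtain ⟨C, hC, h⟩ := exists_abs_sum_vonMangoldt_sub_one_mul_log_pow_four_le
  obtain ⟨c, hc⟩ : ∃ c : ℕ → ℝ, c = fun n => (vonMangoldt n - 1) * Real.log n ^ 4 := ⟨_, rfl⟩
  obtain ⟨D, hD⟩ : ∃ D, D = ∑ n ∈ Finset.Icc 0 64, |c n| := ⟨_, rfl⟩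
  have hD0 : 0 ≤ D := by rw [hD]; positivity
  have hc0 : c 0 = 0 := by simp [hc]
  have hc1 : c 1 = 0 := by simp [hc]
  obtain ⟨K, hK, hfin⟩ := exists_abs_sum_div_log_pow_sub_le (c := c) (κ := 0) (K := C + D)
    (A := 2) (b := 0) (j := 4) (by norm_num) (by positivity) hc0 hc1 (by
      intro t ht
      have hl : 0 ≤ Real.log t := Real.log_nonneg (by linarith)
      rw [zero_mul, sub_zero, pow_zero, inv_one, mul_one]
      rcases le_total 64 t with h64 | h64
      · have h1 := h t h64
        have e : ∑ k ∈ Finset.Icc 0 ⌊t⌋₊, c k =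
            ∑ n ∈ Finset.Icc 1 ⌊t⌋₊, (vonMangoldt n - 1) * Real.log n ^ 4 := by
          rw [Finset.Icc_eq_cons_Ioc (Nat.zero_le _), Finset.sum_cons, hc0, zero_add, hc]
          rfl
        rw [e]
        calc _ ≤ C * (t * Real.log t ^ 2) := h1
          _ ≤ (C + D) * (t * (1 + Real.log t) ^ 2) := by gcongr <;> linarith
      · have h1 : |∑ k ∈ Finset.Icc 0 ⌊t⌋₊, c k| ≤ D := by
          refine (Finset.abs_sum_le_sum_abs _ _).trans ?_
          rw [hD]
          refine Finset.sum_le_sum_of_subset_of_nonneg (Finset.Icc_subset_Icc_right ?_)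
            fun _ _ _ => abs_nonneg _
          exact Nat.floor_le_of_le (by exact_mod_cast h64)
        have h2 : 1 ≤ t * (1 + Real.log t) ^ 2 := by
          have : 1 ≤ (1 + Real.log t) ^ 2 := one_le_pow₀ (by linarith)
          nlinarith
        nlinarith)
  refine ⟨K, hK, fun x hx => ?_⟩
  have h1 := hfin x hx
  rw [zero_mul, sub_zero] at h1
  have e : ∑ k ∈ Finset.Icc 0 ⌊x⌋₊, c k / Real.log k ^ 4 = Chebyshev.psi x - (⌊x⌋₊ - 1) := by
    have h2x : 2 ≤ ⌊x⌋₊ := Nat.le_floor (by exact_mod_cast hx)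
    have h3 : ∑ k ∈ Finset.Icc 0 ⌊x⌋₊, c k / Real.log k ^ 4 =
        ∑ k ∈ Finset.Ioc 1 ⌊x⌋₊, (vonMangoldt k - 1) := by
      rw [Finset.Icc_eq_cons_Ioc (Nat.zero_le _), Finset.sum_cons, hc0, zero_div, zero_add,
        ← Finset.sum_Ioc_consecutive _ zero_le_one (by omega)]
      rw [show Finset.Ioc 0 1 = {1} from rfl, Finset.sum_singleton, hc1, zero_div, zero_add]
      refine Finset.sum_congr rfl fun k hk => ?_
      rw [Finset.mem_Ioc] at hk
      have : 0 < Real.log k := Real.log_pos (by exact_mod_cast hk.1)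
      rw [hc]
      field_simp
    have h4 : Chebyshev.psi x = ∑ k ∈ Finset.Ioc 1 ⌊x⌋₊, vonMangoldt k := by
      rw [Chebyshev.psi, ← Finset.sum_Ioc_consecutive _ zero_le_one (by omega : 1 ≤ ⌊x⌋₊),
        show Finset.Ioc 0 1 = {1} from rfl, Finset.sum_singleton, vonMangoldt_apply_one, zero_add]
    rw [h3, h4, Finset.sum_sub_distrib]
    simp only [Finset.sum_const, Nat.card_Ioc, nsmul_eq_mul, mul_one]
    rw [Nat.cast_sub (by omega), Nat.cast_one]
  rw [e] at h1
  have f1 := Nat.floor_le (by linarith : 0 ≤ x)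
  have f2 := Nat.lt_floor_add_one x
  rw [abs_le] at h1 ⊢
  simp only [show 0 + 4 - 2 = 2 from rfl] at h1
  constructor <;> linarith [h1.1, h1.2]

/-- The indicator of the primes weighted by `log`. -/
noncomputable def primeLog (n : ℕ) : ℝ := if n.Prime then Real.log n else 0

lemma primeLog_nonneg (n : ℕ) : 0 ≤ primeLog n := by
  unfold primeLog
  split_ifs
  · exact Real.log_natCast_nonneg n
  · exact le_rfl

lemma primeLog_le (n : ℕ) : primeLog n ≤ Real.log n := by
  unfold primeLog
  split_ifs
  · exact le_rfl
  · exact Real.log_natCast_nonneg n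

lemma sum_primeLog_eq_theta (x : ℝ) :
    ∑ n ∈ Finset.Icc 0 ⌊x⌋₊, primeLog n = Chebyshev.theta x := by
  rw [Chebyshev.theta_eq_sum_Icc, Finset.sum_filter]
  rfl

/-- The prime number theorem with a saving of two logarithms. -/
lemma exists_abs_sum_primeLog_sub_le :
    ∃ K : ℝ, 0 < K ∧ ∀ x : ℝ, 1 ≤ x →
      |∑ n ∈ Finset.Icc 0 ⌊x⌋₊, primeLog n - x| ≤ K * (x * ((1 + Real.log x) ^ 2)⁻¹) := by
  obtain ⟨K, hK, h⟩ := exists_abs_psi_sub_le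
  obtain ⟨C, hC, h3⟩ := exists_one_add_log_pow_le 3 (ε := 1 / 2) (by norm_num)
  refine ⟨K + 6 * C + 4, by positivity, fun x hx => ?_⟩
  have hl : 0 ≤ Real.log x := Real.log_nonneg hx
  rw [sum_primeLog_eq_theta]
  have hx0 : 0 < x := by linarith
  obtain ⟨G, hG⟩ : ∃ G, G = x * ((1 + Real.log x) ^ 2)⁻¹ := ⟨_, rfl⟩
  have hG0 : 0 < G := by rw [hG]; positivity
  rw [← hG]
  rcases lt_or_ge x 2 with h2 | h2
  · rw [Chebyshev.theta_eq_zero_of_lt_two h2, zero_sub, abs_neg, abs_of_pos hx0]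
    have : (1 + Real.log x) ^ 2 ≤ 4 := by
      have : Real.log x ≤ x - 1 := Real.log_le_sub_one_of_pos hx0
      nlinarith
    have : x ≤ 4 * G := by
      rw [hG, ← div_eq_mul_inv, ← mul_div_assoc, le_div_iff₀ (by positivity)]
      nlinarith
    have : 0 ≤ (K + 6 * C) * G := by positivity
    linarith
  · have h1 := h x h2
    have h4 := Chebyshev.abs_psi_sub_theta_le_sqrt_mul_log (by linarith : 1 ≤ x)
    rw [← hG] at h1
    have h5 : √x * (1 + Real.log x) ≤ C * G := by
      rw [hG, ← div_eq_mul_inv, ← mul_div_assoc, le_div_iff₀ (by positivity)]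
      have := h3 x hx
      rw [← Real.sqrt_eq_rpow] at this
      calc √x * (1 + Real.log x) * (1 + Real.log x) ^ 2 = √x * (1 + Real.log x) ^ 3 := by ring
        _ ≤ √x * (C * √x) := by gcongr
        _ = C * (√x * √x) := by ring
        _ = C * x := by rw [Real.mul_self_sqrt hx0.le]
    have h6 : 1 ≤ √x := Real.one_le_sqrt.mpr hx
    have h7 : √x * Real.log x ≤ C * G := by nlinarith
    have h8 : 1 ≤ C * G := by nlinarith
    have h9 : |Chebyshev.theta x - x| ≤ |Chebyshev.psi x - x| +
        |Chebyshev.psi x - Chebyshev.theta x| := by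
      rw [show Chebyshev.theta x - x = (Chebyshev.psi x - x) -
        (Chebyshev.psi x - Chebyshev.theta x) by ring]
      exact abs_sub _ _
    nlinarith

/-- The relative error `1 / (1 + log t) ^ 2`. -/
noncomputable def invLogSq (t : ℝ) : ℝ := ((1 + Real.log t) ^ 2)⁻¹

lemma invLogSq_pos {t : ℝ} (ht : 1 ≤ t) : 0 < invLogSq t := by
  have := Real.log_nonneg ht
  unfold invLogSq
  positivity

lemma invLogSq_one : invLogSq 1 = 1 := by simp [invLogSq]

lemma invLogSq_anti {t y : ℝ} (ht : 1 ≤ t) (hty : t ≤ y) : invLogSq y ≤ invLogSq t := by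
  have := Real.log_nonneg ht
  unfold invLogSq
  gcongr

lemma invLogSq_le_one {t : ℝ} (ht : 1 ≤ t) : invLogSq t ≤ 1 :=
  (invLogSq_anti le_rfl ht).trans_eq invLogSq_one

lemma exists_invLogSq_le {ε : ℝ} (hε : 0 < ε) :
    ∃ C : ℝ, 0 < C ∧ ∀ t y : ℝ, 1 ≤ t → t ≤ y → invLogSq t ≤ C * (y / t) ^ ε * invLogSq y :=
  exists_inv_one_add_log_pow_le 2 hε

lemma exists_mul_invLogSq_le :
    ∃ C : ℝ, 0 < C ∧ ∀ t y : ℝ, 1 ≤ t → t ≤ y → t * invLogSq t ≤ C * (y * invLogSq y) := by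
  obtain ⟨C, hC, h⟩ := exists_invLogSq_le one_pos
  refine ⟨C, hC, fun t y ht hty => ?_⟩
  have := h t y ht hty
  rw [Real.rpow_one] at this
  calc t * invLogSq t ≤ t * (C * (y / t) * invLogSq y) := by gcongr
    _ = _ := by field_simp

lemma sum_Icc_eq_sum_Ioc_one (f : ℕ → ℝ) {y : ℝ} (hy : 1 ≤ y) :
    ∑ n ∈ Finset.Icc 0 ⌊y⌋₊, f n * primeLog n =
      ∑ n ∈ Finset.Ioc ⌊(1 : ℝ)⌋₊ ⌊y⌋₊, f n * primeLog n := by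
  have h0 : primeLog 0 = 0 := by simp [primeLog]
  have h1 : primeLog 1 = 0 := by simp [primeLog]
  have hy1 : 1 ≤ ⌊y⌋₊ := Nat.le_floor (by exact_mod_cast hy)
  rw [Finset.Icc_eq_cons_Ioc (Nat.zero_le _), Finset.sum_cons, h0, mul_zero, zero_add,
    Nat.floor_one, ← Finset.sum_Ioc_consecutive _ zero_le_one hy1,
    show Finset.Ioc 0 1 = {1} from rfl, Finset.sum_singleton, h1, mul_zero, zero_add]

lemma exists_abs_sum_rpow_mul_primeLog_sub_le {α : ℝ} (hα : 0 < α) :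
    ∃ K : ℝ, 0 < K ∧ ∀ y : ℝ, 1 ≤ y →
      |∑ p ∈ Finset.Icc 0 ⌊y⌋₊, (p : ℝ) ^ α * primeLog p - y ^ (1 + α) / (1 + α)| ≤
        K * (y ^ (1 + α) * invLogSq y) := by
  obtain ⟨K, hK, hθ⟩ := exists_abs_sum_primeLog_sub_le
  obtain ⟨C, hC, hs⟩ := exists_mul_invLogSq_le
  refine ⟨K + K * C + (K + 1) * C, by positivity, fun y hy => ?_⟩
  have hy0 : 0 < y := by linarith
  have hey := invLogSq_pos hy
  have key := abs_sum_mul_sub_integral_le (c := primeLog) (f := fun t => t ^ α)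
    (f' := fun t => α * t ^ (α - 1)) (H := fun t => (α * K * C * (y * invLogSq y)) * t ^ (α - 1))
    (a := 1) (b := y) (κ := 1) zero_le_one hy ?_ ?_ ?_ ?_
  · rw [← sum_Icc_eq_sum_Ioc_one (fun n => (n : ℝ) ^ α) hy, one_mul, one_mul, one_mul,
      integral_rpow (Or.inl (by linarith)), Real.one_rpow, Real.one_rpow, abs_one, one_mul,
      add_comm α 1, intervalIntegral.integral_const_mul,
      abs_of_pos (Real.rpow_pos_of_pos hy0 α)] at key
    have h1 := hθ y hy
    have h2 := hθ 1 le_rfl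
    rw [← invLogSq] at h1 h2
    rw [invLogSq_one] at h2
    have hI := integral_rpow_le_of_neg_one_lt (a := 1) (b := y) (s := α - 1) one_pos (by linarith)
    rw [sub_add_cancel] at hI
    have hyα : y ^ (1 + α) = y * y ^ α := by rw [Real.rpow_add hy0, Real.rpow_one]
    have hyα1 : 1 ≤ y ^ α := Real.one_le_rpow hy hα.le
    have h3 : 1 ≤ C * (y ^ (1 + α) * invLogSq y) := by
      have := hs 1 y le_rfl hy
      rw [invLogSq_one, mul_one] at this
      calc 1 ≤ C * (y * invLogSq y) := this
        _ ≤ y ^ α * (C * (y * invLogSq y)) := le_mul_of_one_le_left (by positivity) hyα1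
        _ = _ := by rw [hyα]; ring
    have h4 : y ^ α * |∑ k ∈ Finset.Icc 0 ⌊y⌋₊, primeLog k - y| ≤
        K * (y ^ (1 + α) * invLogSq y) := by
      calc _ ≤ y ^ α * (K * (y * invLogSq y)) := by gcongr
        _ = _ := by rw [hyα]; ring
    have h5 : α * K * C * (y * invLogSq y) * ∫ t in (1 : ℝ)..y, t ^ (α - 1) ≤
        K * C * (y ^ (1 + α) * invLogSq y) := by
      calc _ ≤ α * K * C * (y * invLogSq y) * (y ^ α / α) := by gcongr
        _ = _ := by rw [hyα]; field_simp
    have h6 : |((y ^ (1 + α) - 1) / (1 + α)) - y ^ (1 + α) / (1 + α)| ≤ 1 := by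
      rw [← sub_div, sub_sub_cancel_left, abs_div, abs_neg, abs_one, abs_of_pos (by linarith)]
      exact (div_le_one (by linarith)).mpr (by linarith)
    have h7 := abs_sub_le (∑ p ∈ Finset.Icc 0 ⌊y⌋₊, (p : ℝ) ^ α * primeLog p)
      ((y ^ (1 + α) - 1) / (1 + α)) (y ^ (1 + α) / (1 + α))
    have h8 : K + 1 ≤ (K + 1) * (C * (y ^ (1 + α) * invLogSq y)) :=
      le_mul_of_one_le_right (by positivity) h3
    rw [mul_one, mul_one] at h2
    refine h7.trans ((add_le_add (key.trans (add_le_add (add_le_add h4 h2) h5)) h6).trans ?_)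
    linarith
  · intro t ht
    exact Real.hasDerivAt_rpow_const (Or.inl (by linarith [ht.1]))
  · intro t ht
    have : t ≠ 0 := by linarith [ht.1]
    exact (continuousAt_const.mul (Real.continuousAt_rpow_const _ _
      (Or.inl this))).continuousWithinAt
  · exact (intervalIntegral.intervalIntegrable_rpow (Or.inr
      (Set.notMem_uIcc_of_lt one_pos hy0))).const_mul _
  · intro t ht
    have ht0 : 0 < t := by linarith [ht.1]
    have h1 := hθ t ht.1
    rw [← invLogSq] at h1
    have h2 := hs t y ht.1 ht.2
    rw [abs_of_nonneg (by positivity), one_mul]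
    calc _ ≤ α * t ^ (α - 1) * (K * (C * (y * invLogSq y))) := by
          gcongr
          exact h1.trans (by gcongr)
      _ = _ := by ring

lemma exists_abs_sum_Ioc_rpow_mul_primeLog_sub_le {β : ℝ} (hβ : 0 < β) :
    ∃ K : ℝ, 0 < K ∧ ∀ z x : ℝ, 1 ≤ z → z ≤ x →
      |∑ q ∈ Finset.Ioc ⌊z⌋₊ ⌊x⌋₊, (q : ℝ) ^ (-1 - β) * primeLog q -
        (z ^ (-β) - x ^ (-β)) / β| ≤ K * (z ^ (-β) * invLogSq z) := by
  obtain ⟨K, hK, hθ⟩ := exists_abs_sum_primeLog_sub_le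
  refine ⟨2 * K + (1 + β) * K / β, by positivity, fun z x hz hzx => ?_⟩
  have hz0 : 0 < z := by linarith
  have hx0 : 0 < x := by linarith
  have hez := invLogSq_pos hz
  have key := abs_sum_mul_sub_integral_le (c := primeLog) (f := fun t => t ^ (-1 - β))
    (f' := fun t => (-1 - β) * t ^ (-1 - β - 1))
    (H := fun t => ((1 + β) * K * invLogSq z) * t ^ (-1 - β))
    (a := z) (b := x) (κ := 1) hz0.le hzx ?_ ?_ ?_ ?_
  · rw [integral_rpow (Or.inr ⟨by linarith, Set.notMem_uIcc_of_lt hz0 hx0⟩), one_mul, one_mul,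
      one_mul, intervalIntegral.integral_const_mul,
      abs_of_pos (Real.rpow_pos_of_pos hx0 _), abs_of_pos (Real.rpow_pos_of_pos hz0 _), show -1 - β + 1 = -β by ring, ← neg_div_neg_eq, neg_neg,
      neg_sub] at key
    have h1 := hθ x (hz.trans hzx)
    have h2 := hθ z hz
    rw [← invLogSq] at h1 h2
    have hI := integral_rpow_le_of_lt_neg_one (s := -1 - β) hz0 hzx (by linarith)
    rw [show -1 - β + 1 = -β by ring, neg_neg] at hI
    have hr : ∀ t : ℝ, 0 < t → t ^ (-1 - β) * t = t ^ (-β) := fun t ht => by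
      nth_rewrite 2 [← Real.rpow_one t]
      rw [← Real.rpow_add ht]; ring_nf
    have h3 : x ^ (-1 - β) * |∑ k ∈ Finset.Icc 0 ⌊x⌋₊, primeLog k - x| ≤
        K * (z ^ (-β) * invLogSq z) := by
      calc _ ≤ x ^ (-1 - β) * (K * (x * invLogSq x)) := by gcongr
        _ = K * (x ^ (-β) * invLogSq x) := by rw [← hr x hx0]; ring
        _ ≤ _ := by
          have a1 := invLogSq_anti hz hzx
          have a2 : x ^ (-β) ≤ z ^ (-β) := Real.rpow_le_rpow_of_nonpos hz0 hzx (by linarith)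
          have a3 := invLogSq_pos (hz.trans hzx)
          gcongr
    have h4 : z ^ (-1 - β) * |∑ k ∈ Finset.Icc 0 ⌊z⌋₊, primeLog k - z| ≤
        K * (z ^ (-β) * invLogSq z) := by
      calc _ ≤ z ^ (-1 - β) * (K * (z * invLogSq z)) := by gcongr
        _ = K * (z ^ (-β) * invLogSq z) := by rw [← hr z hz0]; ring
    have h5 : (1 + β) * K * invLogSq z * ∫ t in z..x, t ^ (-1 - β) ≤
        (1 + β) * K / β * (z ^ (-β) * invLogSq z) := by
      calc _ ≤ (1 + β) * K * invLogSq z * (z ^ (-β) / β) := by gcongr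
        _ = _ := by ring
    linarith
  · intro t ht
    exact Real.hasDerivAt_rpow_const (Or.inl (by linarith [ht.1]))
  · intro t ht
    have : t ≠ 0 := by linarith [ht.1]
    exact (continuousAt_const.mul (Real.continuousAt_rpow_const _ _
      (Or.inl this))).continuousWithinAt
  · exact (intervalIntegral.intervalIntegrable_rpow (Or.inr
      (Set.notMem_uIcc_of_lt hz0 hx0))).const_mul _
  · intro t ht
    have ht1 : 1 ≤ t := hz.trans ht.1
    have ht0 : 0 < t := by linarith
    have h1 := hθ t ht1
    rw [← invLogSq] at h1
    have h2 := invLogSq_anti hz ht.1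
    rw [abs_mul, abs_of_neg (by linarith : -1 - β < 0), abs_of_pos (by positivity), one_mul]
    calc _ ≤ -(-1 - β) * t ^ (-1 - β - 1) * (K * (t * invLogSq z)) := by
          gcongr
          · exact mul_nonneg (by linarith) (by positivity)
          · exact h1.trans (by gcongr)
      _ = (1 + β) * K * invLogSq z * (t ^ (-1 - β - 1) * t) := by ring
      _ = _ := by
          rw [Real.rpow_sub_one ht0.ne']; field_simp

lemma exists_sum_primeLog_le :
    ∃ K : ℝ, 0 < K ∧ ∀ x : ℝ, 1 ≤ x → ∑ n ∈ Finset.Icc 0 ⌊x⌋₊, primeLog n ≤ K * x := by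
  refine ⟨Real.log 4, Real.log_pos (by norm_num), fun x hx => ?_⟩
  rw [sum_primeLog_eq_theta]
  exact Chebyshev.theta_le_log4_mul_x (by linarith)

lemma exists_abs_sum_small_prime_sub_le {α : ℝ} (hα : 0 < α) :
    ∃ K : ℝ, 0 < K ∧ ∀ z : ℝ, 1 ≤ z →
      |∑ q ∈ Finset.Icc 0 ⌊z⌋₊, (q : ℝ) ^ (-α) * primeLog q *
        (∑ p ∈ Finset.range q, (p : ℝ) ^ α * primeLog p) - z ^ 2 / (2 * (1 + α))| ≤
        K * (z ^ 2 * invLogSq z) := by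
  obtain ⟨K, hK, hV⟩ := exists_abs_sum_rpow_mul_primeLog_sub_le hα
  obtain ⟨K₁, hK₁, hV₁⟩ := exists_abs_sum_rpow_mul_primeLog_sub_le one_pos
  obtain ⟨C, hC, hs⟩ := exists_mul_invLogSq_le
  obtain ⟨B, hB, hθ⟩ := exists_sum_primeLog_le
  obtain ⟨D, hD, hl⟩ := exists_one_add_log_pow_le 3 one_pos
  refine ⟨K₁ + (K * C + D) * B, by positivity, fun z hz => ?_⟩
  have hz0 : 0 < z := by linarith
  have hez := invLogSq_pos hz
  have hlz : 0 ≤ Real.log z := Real.log_nonneg hz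
  have hlog : Real.log z ≤ D * (z * invLogSq z) := by
    have := hl z hz
    rw [Real.rpow_one] at this
    rw [invLogSq, ← mul_assoc, ← div_eq_mul_inv, le_div_iff₀ (by positivity)]
    refine le_trans ?_ this
    rw [pow_succ' _ 2]
    gcongr
    linarith
  have hpt : ∀ q ∈ Finset.Icc 0 ⌊z⌋₊, |(q : ℝ) ^ (-α) * primeLog q *
      (∑ p ∈ Finset.range q, (p : ℝ) ^ α * primeLog p) - (q : ℝ) ^ (1 : ℝ) * primeLog q / (1 + α)| ≤
      (K * C + D) * (z * invLogSq z) * primeLog q := by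
    intro q hq
    by_cases hp : q.Prime
    · have hq1 : (1 : ℝ) ≤ q := by exact_mod_cast hp.one_lt.le
      have hq0 : (0 : ℝ) < q := by linarith
      have hqz : (q : ℝ) ≤ z := (Nat.le_floor_iff hz0.le).mp (Finset.mem_Icc.mp hq).2
      have h1 := hV q hq1
      have hsum : ∑ p ∈ Finset.Icc 0 ⌊(q : ℝ)⌋₊, (p : ℝ) ^ α * primeLog p =
          (∑ p ∈ Finset.range q, (p : ℝ) ^ α * primeLog p) + (q : ℝ) ^ α * primeLog q := by
        rw [Nat.floor_natCast, ← Nat.range_succ_eq_Icc_zero, Finset.sum_range_succ]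
      rw [hsum] at h1
      have hα1 : (q : ℝ) ^ (-α) * (q : ℝ) ^ (1 + α) = q := by
        rw [← Real.rpow_add hq0]; ring_nf; exact Real.rpow_one _
      have hα2 : (q : ℝ) ^ (-α) * (q : ℝ) ^ α = 1 := by
        rw [← Real.rpow_add hq0]; ring_nf; exact Real.rpow_zero _
      have e : (q : ℝ) ^ (-α) * primeLog q *
          (∑ p ∈ Finset.range q, (p : ℝ) ^ α * primeLog p) -
          (q : ℝ) ^ (1 : ℝ) * primeLog q / (1 + α) =
          primeLog q * ((q : ℝ) ^ (-α) * ((∑ p ∈ Finset.range q, (p : ℝ) ^ α * primeLog p) +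
            (q : ℝ) ^ α * primeLog q - (q : ℝ) ^ (1 + α) / (1 + α)) - primeLog q) := by
        rw [Real.rpow_one]
        linear_combination (primeLog q / (1 + α)) * hα1 - primeLog q * primeLog q * hα2
      rw [e, abs_mul, abs_of_nonneg (primeLog_nonneg q), mul_comm]
      refine mul_le_mul_of_nonneg_right ?_ (primeLog_nonneg q)
      have h2 : primeLog q ≤ D * (z * invLogSq z) :=
        (primeLog_le q).trans ((Real.log_le_log hq0 hqz).trans hlog)
      have h3 : |(q : ℝ) ^ (-α) * ((∑ p ∈ Finset.range q, (p : ℝ) ^ α * primeLog p) +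
            (q : ℝ) ^ α * primeLog q - (q : ℝ) ^ (1 + α) / (1 + α))| ≤
            K * C * (z * invLogSq z) := by
        rw [abs_mul, abs_of_pos (by positivity)]
        calc _ ≤ (q : ℝ) ^ (-α) * (K * ((q : ℝ) ^ (1 + α) * invLogSq q)) := by gcongr
          _ = K * (((q : ℝ) ^ (-α) * (q : ℝ) ^ (1 + α)) * invLogSq q) := by ring
          _ = K * (q * invLogSq q) := by rw [hα1]
          _ ≤ K * (C * (z * invLogSq z)) := mul_le_mul_of_nonneg_left (hs q z hq1 hqz) hK.le
          _ = _ := by ring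
      refine (abs_sub _ _).trans ?_
      rw [abs_of_nonneg (primeLog_nonneg q)]
      linarith
    · simp [primeLog, hp]
  have h1 := hV₁ z hz
  have h2 : |∑ q ∈ Finset.Icc 0 ⌊z⌋₊, ((q : ℝ) ^ (-α) * primeLog q *
      (∑ p ∈ Finset.range q, (p : ℝ) ^ α * primeLog p) -
      (q : ℝ) ^ (1 : ℝ) * primeLog q / (1 + α))| ≤ (K * C + D) * B * (z ^ 2 * invLogSq z) := by
    refine (Finset.abs_sum_le_sum_abs _ _).trans ((Finset.sum_le_sum hpt).trans ?_)
    rw [← Finset.mul_sum]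
    calc _ ≤ (K * C + D) * (z * invLogSq z) * (B * z) := by gcongr; exact hθ z hz
      _ = _ := by ring
  rw [Finset.sum_sub_distrib, ← Finset.sum_div] at h2
  have e2 : z ^ (1 + 1 : ℝ) = z ^ 2 := by norm_num
  rw [e2] at h1
  have h3 : |(∑ p ∈ Finset.Icc 0 ⌊z⌋₊, (p : ℝ) ^ (1 : ℝ) * primeLog p) / (1 + α) -
      z ^ 2 / (2 * (1 + α))| ≤ K₁ * (z ^ 2 * invLogSq z) := by
    rw [← div_div, ← sub_div, abs_div, abs_of_pos (by linarith : 0 < 1 + α)]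
    refine (div_le_self (abs_nonneg _) (by linarith)).trans ?_
    norm_num at h1 ⊢
    exact h1
  refine (abs_sub_le _ _ _).trans ((add_le_add h2 h3).trans (le_of_eq ?_))
  ring

lemma exists_abs_sum_large_prime_sub_le {α : ℝ} (hα : 0 < α) :
    ∃ K : ℝ, 0 < K ∧ ∀ z : ℝ, 1 ≤ z →
      |∑ q ∈ Finset.Ioc ⌊z⌋₊ ⌊z ^ 2⌋₊, (q : ℝ) ^ (-α) * primeLog q *
        (∑ p ∈ Finset.Icc 0 ⌊z ^ 2 / q⌋₊, (p : ℝ) ^ α * primeLog p) -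
          z ^ 2 / (2 * α * (1 + α))| ≤ K * (z ^ 2 * invLogSq z) := by
  obtain ⟨K, hK, hV⟩ := exists_abs_sum_rpow_mul_primeLog_sub_le hα
  obtain ⟨K₁, hK₁, hT₁⟩ := exists_abs_sum_Ioc_rpow_mul_primeLog_sub_le hα
  obtain ⟨K₂, hK₂, hT₂⟩ :=
    exists_abs_sum_Ioc_rpow_mul_primeLog_sub_le (show 0 < 2 * α by linarith)
  obtain ⟨C, hC, hs⟩ := exists_invLogSq_le hα
  obtain ⟨D, hD, hs₂⟩ := exists_invLogSq_le (show 0 < 2 * α by linarith)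
  refine ⟨K * C * (1 / α + K₁) + (K₂ + D / (2 * α)), by positivity, fun z hz => ?_⟩
  have hz0 : 0 < z := by linarith
  have hzz : z ≤ z ^ 2 := by nlinarith
  have hez := invLogSq_pos hz
  have hpt : ∀ q ∈ Finset.Ioc ⌊z⌋₊ ⌊z ^ 2⌋₊, |(q : ℝ) ^ (-α) * primeLog q *
        (∑ p ∈ Finset.Icc 0 ⌊z ^ 2 / q⌋₊, (p : ℝ) ^ α * primeLog p) -
        (z ^ 2) ^ (1 + α) / (1 + α) * ((q : ℝ) ^ (-1 - 2 * α) * primeLog q)| ≤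
      K * C * (z ^ α * z ^ 2 * invLogSq z) * ((q : ℝ) ^ (-1 - α) * primeLog q) := by
    intro q hq
    rw [Finset.mem_Ioc] at hq
    have hzq : z < q := (Nat.floor_lt hz0.le).mp hq.1
    have hqz : (q : ℝ) ≤ z ^ 2 := (Nat.le_floor_iff (by positivity)).mp hq.2
    have hq0 : (0 : ℝ) < q := by linarith
    have hy1 : 1 ≤ z ^ 2 / q := (one_le_div hq0).mpr hqz
    have hyz : z ^ 2 / q ≤ z := by
      rw [div_le_iff₀ hq0, sq]
      gcongr
    have hy0 : 0 < z ^ 2 / q := by linarith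
    have h1 := hV _ hy1
    have h2 := hs _ _ hy1 hyz
    have h3 : (z ^ 2 / q) ^ (1 + α) = (z ^ 2) ^ (1 + α) * (q : ℝ) ^ (-1 - α) := by
      rw [Real.div_rpow (by positivity) hq0.le, show -1 - α = -(1 + α) by ring,
        Real.rpow_neg hq0.le, div_eq_mul_inv]
    have h4 : (q : ℝ) ^ (-α) * (q : ℝ) ^ (-1 - α) = (q : ℝ) ^ (-1 - 2 * α) := by
      rw [← Real.rpow_add hq0]; ring_nf
    have h5 : (z ^ 2 / q) ^ (1 + α) * (z / (z ^ 2 / q)) ^ α = z ^ α * (z ^ 2 / q) := by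
      rw [Real.div_rpow hz0.le hy0.le, Real.rpow_add hy0, Real.rpow_one]
      have := (Real.rpow_pos_of_pos hy0 α).ne'
      rw [mul_assoc, mul_div_cancel₀ _ this, mul_comm]
    have h6 : (q : ℝ) ^ (-1 - α) = (q : ℝ) ^ (-α) / q := by
      rw [show -1 - α = -α - 1 by ring, Real.rpow_sub_one hq0.ne']
    have e : (q : ℝ) ^ (-α) * primeLog q *
        (∑ p ∈ Finset.Icc 0 ⌊z ^ 2 / q⌋₊, (p : ℝ) ^ α * primeLog p) -
        (z ^ 2) ^ (1 + α) / (1 + α) * ((q : ℝ) ^ (-1 - 2 * α) * primeLog q) =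
        (q : ℝ) ^ (-α) * primeLog q *
        ((∑ p ∈ Finset.Icc 0 ⌊z ^ 2 / q⌋₊, (p : ℝ) ^ α * primeLog p) -
          (z ^ 2 / q) ^ (1 + α) / (1 + α)) := by
      rw [h3, ← h4]; ring
    have hl := primeLog_nonneg q
    rw [e, abs_mul, abs_of_nonneg (by positivity)]
    calc _ ≤ (q : ℝ) ^ (-α) * primeLog q * (K * ((z ^ 2 / q) ^ (1 + α) *
          (C * (z / (z ^ 2 / q)) ^ α * invLogSq z))) := by
          refine mul_le_mul_of_nonneg_left (h1.trans ?_) (by positivity)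
          gcongr
      _ = (q : ℝ) ^ (-α) * primeLog q * (K * C * invLogSq z * ((z ^ 2 / q) ^ (1 + α) *
          (z / (z ^ 2 / q)) ^ α)) := by ring
      _ = _ := by rw [h5, h6]; ring
  have hsum₁ : ∑ q ∈ Finset.Ioc ⌊z⌋₊ ⌊z ^ 2⌋₊, (q : ℝ) ^ (-1 - α) * primeLog q ≤
      (1 / α + K₁) * z ^ (-α) := by
    have h1 := (abs_le.mp (hT₁ z (z ^ 2) hz hzz)).2
    have h2 : K₁ * (z ^ (-α) * invLogSq z) ≤ K₁ * z ^ (-α) := by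
      gcongr
      exact mul_le_of_le_one_right (by positivity) (invLogSq_le_one hz)
    have h3 : (z ^ (-α) - (z ^ 2) ^ (-α)) / α ≤ 1 / α * z ^ (-α) := by
      rw [one_div, inv_mul_eq_div]
      gcongr
      linarith [Real.rpow_pos_of_pos (show 0 < z ^ 2 by positivity) (-α)]
    linarith
  have hzα : z ^ α * z ^ (-α) = 1 := by
    rw [← Real.rpow_add hz0, add_neg_cancel, Real.rpow_zero]
  have h1 : |∑ q ∈ Finset.Ioc ⌊z⌋₊ ⌊z ^ 2⌋₊, ((q : ℝ) ^ (-α) * primeLog q *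
        (∑ p ∈ Finset.Icc 0 ⌊z ^ 2 / q⌋₊, (p : ℝ) ^ α * primeLog p) -
        (z ^ 2) ^ (1 + α) / (1 + α) * ((q : ℝ) ^ (-1 - 2 * α) * primeLog q))| ≤
      K * C * (1 / α + K₁) * (z ^ 2 * invLogSq z) := by
    refine (Finset.abs_sum_le_sum_abs _ _).trans ((Finset.sum_le_sum hpt).trans ?_)
    rw [← Finset.mul_sum]
    calc _ ≤ K * C * (z ^ α * z ^ 2 * invLogSq z) * ((1 / α + K₁) * z ^ (-α)) := by gcongr
      _ = K * C * (1 / α + K₁) * (z ^ 2 * invLogSq z) * (z ^ α * z ^ (-α)) := by ring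
      _ = _ := by rw [hzα, mul_one]
  have hzz0 : (0 : ℝ) < z ^ 2 := by positivity
  have hA : (z ^ 2) ^ (1 + α) * z ^ (-(2 * α)) = z ^ 2 := by
    rw [← Real.rpow_natCast z 2, ← Real.rpow_mul hz0.le, ← Real.rpow_add hz0]
    congr 1; push_cast; ring
  have hB : (z ^ 2) ^ (1 + α) * (z ^ 2) ^ (-(2 * α)) = z ^ 2 * z ^ (-(2 * α)) := by
    rw [← Real.rpow_natCast z 2, ← Real.rpow_mul hz0.le, ← Real.rpow_mul hz0.le,
      ← Real.rpow_add hz0, ← Real.rpow_add hz0]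
    congr 1; push_cast; ring
  have hE : z ^ (-(2 * α)) ≤ D * invLogSq z := by
    have := hs₂ 1 z le_rfl hz
    rw [invLogSq_one, div_one] at this
    have h2 : z ^ (2 * α) * z ^ (-(2 * α)) = 1 := by
      rw [← Real.rpow_add hz0, add_neg_cancel, Real.rpow_zero]
    calc z ^ (-(2 * α)) ≤ z ^ (-(2 * α)) * (D * z ^ (2 * α) * invLogSq z) :=
          le_mul_of_one_le_right (by positivity) this
      _ = D * invLogSq z * (z ^ (2 * α) * z ^ (-(2 * α))) := by ring
      _ = _ := by rw [h2, mul_one]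
  have h2 : |(z ^ 2) ^ (1 + α) / (1 + α) *
      (∑ q ∈ Finset.Ioc ⌊z⌋₊ ⌊z ^ 2⌋₊, (q : ℝ) ^ (-1 - 2 * α) * primeLog q) -
      z ^ 2 / (2 * α * (1 + α))| ≤ (K₂ + D / (2 * α)) * (z ^ 2 * invLogSq z) := by
    have h3 := hT₂ z (z ^ 2) hz hzz
    have e1 : (z ^ 2) ^ (1 + α) / (1 + α) * ((z ^ (-(2 * α)) - (z ^ 2) ^ (-(2 * α))) / (2 * α)) =
        z ^ 2 / (2 * α * (1 + α)) - z ^ 2 * z ^ (-(2 * α)) / (2 * α * (1 + α)) := by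
      simp only [← div_div]
      linear_combination (hA - hB) / (2 * α) / (1 + α)
    have h4 : |(z ^ 2) ^ (1 + α) / (1 + α) *
      (∑ q ∈ Finset.Ioc ⌊z⌋₊ ⌊z ^ 2⌋₊, (q : ℝ) ^ (-1 - 2 * α) * primeLog q) -
        (z ^ 2) ^ (1 + α) / (1 + α) * ((z ^ (-(2 * α)) - (z ^ 2) ^ (-(2 * α))) / (2 * α))| ≤
        K₂ * (z ^ 2 * invLogSq z) := by
      rw [← mul_sub, abs_mul, abs_of_pos (by positivity)]
      calc _ ≤ (z ^ 2) ^ (1 + α) / (1 + α) * (K₂ * (z ^ (-(2 * α)) * invLogSq z)) := by gcongr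
        _ ≤ (z ^ 2) ^ (1 + α) * (K₂ * (z ^ (-(2 * α)) * invLogSq z)) := by
          gcongr
          exact div_le_self (by positivity) (by linarith)
        _ = K₂ * (((z ^ 2) ^ (1 + α) * z ^ (-(2 * α))) * invLogSq z) := by ring
        _ = _ := by rw [hA]
    have h5 : z ^ 2 * z ^ (-(2 * α)) / (2 * α * (1 + α)) ≤ D / (2 * α) * (z ^ 2 * invLogSq z) := by
      calc _ ≤ z ^ 2 * (D * invLogSq z) / (2 * α * (1 + α)) := by gcongr
        _ = D / (2 * α) * (z ^ 2 * invLogSq z) / (1 + α) := by field_simp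
        _ ≤ _ := div_le_self (by positivity) (by linarith)
    have h6 : 0 ≤ z ^ 2 * z ^ (-(2 * α)) / (2 * α * (1 + α)) := by positivity
    rw [e1] at h4
    rw [abs_le] at h4 ⊢
    constructor <;> linarith
  rw [Finset.sum_sub_distrib, ← Finset.mul_sum] at h1
  refine (abs_sub_le _ _ _).trans ((add_le_add h1 h2).trans (le_of_eq ?_))
  ring

lemma primeFactors_prime_mul {p q : ℕ} (hp : p.Prime) (hq : q.Prime) :
    (p * q).primeFactors = {p, q} := by
  rw [Nat.primeFactors_mul hp.ne_zero hq.ne_zero, hp.primeFactors, hq.primeFactors]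
  rfl

lemma squarefree_prime_mul {p q : ℕ} (hp : p.Prime) (hq : q.Prime) (h : p < q) :
    Squarefree (p * q) :=
  (Nat.squarefree_mul ((Nat.coprime_primes hp hq).mpr h.ne)).mpr
    ⟨hp.prime.squarefree, hq.prime.squarefree⟩

lemma card_primeFactors_prime_mul {p q : ℕ} (hp : p.Prime) (hq : q.Prime) (h : p < q) :
    (p * q).primeFactors.card = 2 := by
  rw [primeFactors_prime_mul hp hq, Finset.card_pair h.ne]

lemma sup_primeFactors_prime_mul {p q : ℕ} (hp : p.Prime) (hq : q.Prime) (h : p < q) :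
    (p * q).primeFactors.sup id = q := by
  rw [primeFactors_prime_mul hp hq]
  simp [h.le]

lemma minFac_prime_mul {p q : ℕ} (hp : p.Prime) (hq : q.Prime) (h : p < q) :
    (p * q).minFac = p := by
  refine le_antisymm (Nat.minFac_le_of_dvd hp.two_le (dvd_mul_right p q)) ?_
  have h1 : p * q ≠ 1 := (Nat.one_lt_mul_iff.mpr ⟨hp.pos, hq.pos, Or.inl hp.one_lt⟩).ne'
  rcases (Nat.minFac_prime h1).dvd_mul.mp (Nat.minFac_dvd _) with hd | hd
  · exact ((Nat.prime_dvd_prime_iff_eq (Nat.minFac_prime h1) hp).mp hd).ge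
  · exact h.le.trans ((Nat.prime_dvd_prime_iff_eq (Nat.minFac_prime h1) hq).mp hd).ge

lemma exists_eq_prime_mul {n : ℕ} (hn : Squarefree n ∧ n.primeFactors.card = 2) :
    ∃ p q : ℕ, p.Prime ∧ q.Prime ∧ p < q ∧ n = p * q := by
  obtain ⟨a, b, hab, h⟩ := Finset.card_eq_two.mp hn.2
  have hprod := Nat.prod_primeFactors_of_squarefree hn.1
  have ha : a.Prime := Nat.prime_of_mem_primeFactors (n := n) (by simp [h])
  have hb : b.Prime := Nat.prime_of_mem_primeFactors (n := n) (by simp [h])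
  rw [h, Finset.prod_pair hab] at hprod
  rcases hab.lt_or_gt with hlt | hlt
  · exact ⟨a, b, ha, hb, hlt, hprod.symm⟩
  · exact ⟨b, a, hb, ha, hlt, by rw [← hprod, mul_comm]⟩

/-- The function equal to `f p q` at a product of two primes `p < q`, and to `0` elsewhere. -/
noncomputable def primePairWeight (f : ℕ → ℕ → ℝ) (n : ℕ) : ℝ :=
  if Squarefree n ∧ n.primeFactors.card = 2 then f n.minFac (n.primeFactors.sup id) else 0

lemma primePairWeight_mul (f : ℕ → ℕ → ℝ) {p q : ℕ} (hp : p.Prime) (hq : q.Prime) (h : p < q) :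
    primePairWeight f (p * q) = f p q := by
  rw [primePairWeight, if_pos ⟨squarefree_prime_mul hp hq h, card_primeFactors_prime_mul hp hq h⟩,
    minFac_prime_mul hp hq h, sup_primeFactors_prime_mul hp hq h]

lemma primePairWeight_cases (n : ℕ) :
    (∀ f, primePairWeight f n = 0) ∨
      ∃ p q : ℕ, p.Prime ∧ q.Prime ∧ p < q ∧ n = p * q ∧ ∀ f, primePairWeight f n = f p q := by
  by_cases hn : Squarefree n ∧ n.primeFactors.card = 2
  · obtain ⟨p, q, hp, hq, h, rfl⟩ := exists_eq_prime_mul hn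
    exact Or.inr ⟨p, q, hp, hq, h, rfl, fun f => primePairWeight_mul f hp hq h⟩
  · exact Or.inl fun f => if_neg hn

lemma sum_primePairWeight (f : ℕ → ℕ → ℝ) (N : ℕ) :
    ∑ n ∈ Finset.Icc 0 N, primePairWeight f n =
      ∑ q ∈ (Finset.Icc 0 N).filter Nat.Prime,
        ∑ p ∈ (Finset.Icc 0 (N / q)).filter (fun p => p.Prime ∧ p < q), f p q := by
  rw [Finset.sum_sigma']
  unfold primePairWeight
  rw [← Finset.sum_filter]
  refine Finset.sum_nbij' (fun n => ⟨n.primeFactors.sup id, n.minFac⟩) (fun a => a.2 * a.1)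
    ?_ ?_ ?_ ?_ ?_
  · intro n hn
    obtain ⟨hn1, hn2⟩ := Finset.mem_filter.mp hn
    obtain ⟨p, q, hp, hq, h, rfl⟩ := exists_eq_prime_mul hn2
    have hN := (Finset.mem_Icc.mp hn1).2
    simp only [minFac_prime_mul hp hq h, sup_primeFactors_prime_mul hp hq h, Finset.mem_sigma,
      Finset.mem_filter, Finset.mem_Icc, Nat.zero_le, true_and]
    exact ⟨⟨(Nat.le_mul_of_pos_left q hp.pos).trans hN, hq⟩,
      (Nat.le_div_iff_mul_le hq.pos).mpr hN, hp, h⟩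
  · rintro ⟨q, p⟩ ha
    simp only [Finset.mem_sigma, Finset.mem_filter, Finset.mem_Icc, Nat.zero_le, true_and] at ha ⊢
    obtain ⟨⟨hqN, hq⟩, hpN, hp, h⟩ := ha
    exact ⟨(Nat.le_div_iff_mul_le hq.pos).mp hpN, squarefree_prime_mul hp hq h,
      card_primeFactors_prime_mul hp hq h⟩
  · intro n hn
    obtain ⟨p, q, hp, hq, h, rfl⟩ := exists_eq_prime_mul (Finset.mem_filter.mp hn).2
    simp only [minFac_prime_mul hp hq h, sup_primeFactors_prime_mul hp hq h]
  · rintro ⟨q, p⟩ ha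
    simp only [Finset.mem_sigma, Finset.mem_filter, Finset.mem_Icc, Nat.zero_le, true_and] at ha
    obtain ⟨⟨hqN, hq⟩, hpN, hp, h⟩ := ha
    simp only [minFac_prime_mul hp hq h, sup_primeFactors_prime_mul hp hq h]
  · intro n hn
    rfl

/-- The summand `(p / q) ^ α * log p * log q` at `n = p * q` with primes `p < q`. -/
noncomputable def pairLogWeight (α : ℝ) : ℕ → ℝ :=
  primePairWeight fun p q => ((p : ℝ) / q) ^ α * Real.log p * Real.log q

lemma sum_pairLogWeight (α : ℝ) (N : ℕ) :
    ∑ n ∈ Finset.Icc 0 N, pairLogWeight α n =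
      ∑ q ∈ Finset.Icc 0 N, (q : ℝ) ^ (-α) * primeLog q *
        ∑ p ∈ (Finset.Icc 0 (N / q)).filter (fun p => p < q), (p : ℝ) ^ α * primeLog p := by
  rw [pairLogWeight, sum_primePairWeight, Finset.sum_filter]
  refine Finset.sum_congr rfl fun q _ => ?_
  split_ifs with hq
  · rw [Finset.mul_sum, Finset.sum_filter, Finset.sum_filter]
    refine Finset.sum_congr rfl fun p _ => ?_
    by_cases hp : p.Prime
    · by_cases h : p < q
      · simp only [hp, h, and_self, if_true, primeLog, hq]
        rw [Real.div_rpow (Nat.cast_nonneg p) (Nat.cast_nonneg q), Real.rpow_neg (Nat.cast_nonneg q)]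
        ring
      · simp [h]
    · simp [hp, primeLog]
  · simp [primeLog, hq]

lemma exists_abs_sum_pairLogWeight_sub_le {α : ℝ} (hα : 0 < α) :
    ∃ K : ℝ, 0 < K ∧ ∀ x : ℝ, 1 ≤ x →
      |∑ n ∈ Finset.Icc 0 ⌊x⌋₊, pairLogWeight α n - 1 / (2 * α) * x| ≤
        K * (x * ((1 + Real.log x) ^ 2)⁻¹) := by
  obtain ⟨K₁, hK₁, h₁⟩ := exists_abs_sum_small_prime_sub_le hα
  obtain ⟨K₂, hK₂, h₂⟩ := exists_abs_sum_large_prime_sub_le hα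
  refine ⟨4 * (K₁ + K₂), by positivity, fun x hx => ?_⟩
  obtain ⟨z, hz, rfl⟩ : ∃ z : ℝ, 1 ≤ z ∧ x = z ^ 2 :=
    ⟨Real.sqrt x, Real.one_le_sqrt.mpr hx, (Real.sq_sqrt (by linarith)).symm⟩
  have hz0 : 0 < z := by linarith
  have hzz : z ≤ z ^ 2 := by nlinarith
  have hfl : ⌊z⌋₊ ≤ ⌊z ^ 2⌋₊ := Nat.floor_mono hzz
  have e : ∑ n ∈ Finset.Icc 0 ⌊z ^ 2⌋₊, pairLogWeight α n =
      (∑ q ∈ Finset.Icc 0 ⌊z⌋₊, (q : ℝ) ^ (-α) * primeLog q *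
        (∑ p ∈ Finset.range q, (p : ℝ) ^ α * primeLog p)) +
      ∑ q ∈ Finset.Ioc ⌊z⌋₊ ⌊z ^ 2⌋₊, (q : ℝ) ^ (-α) * primeLog q *
        (∑ p ∈ Finset.Icc 0 ⌊z ^ 2 / q⌋₊, (p : ℝ) ^ α * primeLog p) := by
    have hsplit : Finset.Icc 0 ⌊z ^ 2⌋₊ = Finset.Icc 0 ⌊z⌋₊ ∪ Finset.Ioc ⌊z⌋₊ ⌊z ^ 2⌋₊ := by
      ext n
      simp only [Finset.mem_union, Finset.mem_Icc, Finset.mem_Ioc]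
      omega
    rw [sum_pairLogWeight]
    conv_lhs => rw [hsplit]
    rw [Finset.sum_union (by
      rw [Finset.disjoint_left]
      intro n
      simp only [Finset.mem_Icc, Finset.mem_Ioc]
      omega)]
    congr 1
    · refine Finset.sum_congr rfl fun q hq => ?_
      by_cases hp : q.Prime
      · have hqz : (q : ℝ) ≤ z := (Nat.le_floor_iff hz0.le).mp (Finset.mem_Icc.mp hq).2
        have hqq : q * q ≤ ⌊z ^ 2⌋₊ := by
          refine Nat.le_floor ?_
          push_cast
          rw [sq]
          gcongr
        have hqd : q ≤ ⌊z ^ 2⌋₊ / q := (Nat.le_div_iff_mul_le hp.pos).mpr hqq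
        congr 2
        ext p
        simp only [Finset.mem_filter, Finset.mem_Icc, Finset.mem_range]
        omega
      · simp [primeLog, hp]
    · refine Finset.sum_congr rfl fun q hq => ?_
      have hzq : z < q := (Nat.floor_lt hz0.le).mp (Finset.mem_Ioc.mp hq).1
      have hq0 : (0 : ℝ) < q := by linarith
      rw [Nat.floor_div_natCast]
      congr 2
      refine Finset.filter_true_of_mem fun p hp => ?_
      have h1 : p * q ≤ ⌊z ^ 2⌋₊ :=
        (Nat.le_div_iff_mul_le (by exact_mod_cast hq0)).mp (Finset.mem_Icc.mp hp).2
      have h2 : (p : ℝ) * q ≤ z ^ 2 := by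
        exact_mod_cast (Nat.le_floor_iff (by positivity)).mp h1
      have h3 : (p : ℝ) < q := by
        by_contra! hc
        nlinarith
      exact_mod_cast h3
  have hlog : invLogSq z ≤ 4 * ((1 + Real.log (z ^ 2)) ^ 2)⁻¹ := by
    have hl := Real.log_nonneg hz
    rw [Real.log_pow, invLogSq, ← div_eq_mul_inv, ← one_div,
      div_le_div_iff₀ (by positivity) (by positivity)]
    push_cast
    nlinarith
  have e2 : 1 / (2 * α) * z ^ 2 = z ^ 2 / (2 * (1 + α)) + z ^ 2 / (2 * α * (1 + α)) := by
    field_simp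
    ring
  rw [e, e2, add_sub_add_comm]
  refine (abs_add_le _ _).trans ((add_le_add (h₁ z hz) (h₂ z hz)).trans ?_)
  calc _ = (K₁ + K₂) * (z ^ 2 * invLogSq z) := by ring
    _ ≤ (K₁ + K₂) * (z ^ 2 * (4 * ((1 + Real.log (z ^ 2)) ^ 2)⁻¹)) := by gcongr
    _ = _ := by ring

lemma hasDerivAt_div_log_sq_add {t : ℝ} (ht : 1 < t) :
    HasDerivAt (fun t : ℝ => t / Real.log t ^ 2 + 2 * (t / Real.log t ^ 3))
      ((Real.log t ^ 2)⁻¹ - 6 * (Real.log t ^ 4)⁻¹) t := by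
  have ht0 : t ≠ 0 := by linarith
  have hl : Real.log t ≠ 0 := (Real.log_pos ht).ne'
  have h1 := Real.hasDerivAt_log ht0
  have h2 := (hasDerivAt_id' t).fun_div (h1.fun_pow 2) (pow_ne_zero 2 hl)
  have h3 := ((hasDerivAt_id' t).fun_div (h1.fun_pow 3) (pow_ne_zero 3 hl)).const_mul 2
  refine (h2.fun_add h3).congr_deriv ?_
  field_simp
  push_cast
  ring

lemma continuousOn_inv_log_pow (m : ℕ) {x : ℝ} :
    ContinuousOn (fun t : ℝ => (Real.log t ^ m)⁻¹) (Set.Icc 2 x) := by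
  intro t ht
  have h1 : 1 < t := by linarith [ht.1]
  have h0 : t ≠ 0 := by linarith
  exact (((Real.continuousAt_log h0).pow m).inv₀
    (pow_ne_zero m (Real.log_pos h1).ne')).continuousWithinAt

lemma intervalIntegrable_inv_log_pow (m : ℕ) {x : ℝ} (hx : 2 ≤ x) :
    IntervalIntegrable (fun t : ℝ => (Real.log t ^ m)⁻¹) MeasureTheory.volume 2 x :=
  ContinuousOn.intervalIntegrable (by rw [Set.uIcc_of_le hx]; exact continuousOn_inv_log_pow m)

lemma exists_integral_inv_log_pow_four_le :
    ∃ C : ℝ, 0 < C ∧ ∀ x : ℝ, 2 ≤ x →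
      ∫ t in (2 : ℝ)..x, (Real.log t ^ 4)⁻¹ ≤ C * (x * ((1 + Real.log x) ^ 4)⁻¹) := by
  obtain ⟨C, hC, h⟩ := exists_inv_one_add_log_pow_le 4 (show (0 : ℝ) < 1 / 2 by norm_num)
  refine ⟨81 * C * 2, by positivity, fun x hx => ?_⟩
  have hx0 : 0 < x := by linarith
  have hlx : 0 ≤ Real.log x := Real.log_nonneg (by linarith)
  have hpt : ∀ t ∈ Set.Icc 2 x, (Real.log t ^ 4)⁻¹ ≤
      81 * C * x ^ (1 / 2 : ℝ) * ((1 + Real.log x) ^ 4)⁻¹ * t ^ (-(1 / 2) : ℝ) := by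
    intro t ht
    have ht0 : 0 < t := by linarith [ht.1]
    have hl2 : 1 / 2 ≤ Real.log t := by
      have h1 := Real.log_two_gt_d9
      have h2 := Real.log_le_log two_pos ht.1
      linarith
    have h1 := h t x (by linarith [ht.1]) ht.2
    have h2 : (Real.log t ^ 4)⁻¹ ≤ 81 * ((1 + Real.log t) ^ 4)⁻¹ := by
      have : (1 + Real.log t) ^ 4 ≤ (3 * Real.log t) ^ 4 := by gcongr; linarith
      rw [← div_eq_mul_inv, ← one_div, div_le_div_iff₀ (by positivity) (by positivity)]
      rw [mul_pow] at this
      linarith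
    rw [Real.rpow_neg ht0.le, ← div_eq_mul_inv]
    rw [Real.div_rpow hx0.le ht0.le] at h1
    calc _ ≤ 81 * (C * (x ^ (1 / 2 : ℝ) / t ^ (1 / 2 : ℝ)) * ((1 + Real.log x) ^ 4)⁻¹) := by
          linarith
      _ = _ := by ring
  have hi : IntervalIntegrable (fun t : ℝ => t ^ (-(1 / 2) : ℝ)) MeasureTheory.volume 2 x :=
    intervalIntegral.intervalIntegrable_rpow (Or.inr (Set.notMem_uIcc_of_lt two_pos hx0))
  have h1 := intervalIntegral.integral_mono_on hx (intervalIntegrable_inv_log_pow 4 hx)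
    (hi.const_mul _) hpt
  rw [intervalIntegral.integral_const_mul] at h1
  have h2 := integral_rpow_le_of_neg_one_lt (a := 2) (b := x) (s := -(1 / 2)) two_pos (by norm_num)
  refine h1.trans ?_
  have h3 : x ^ (1 / 2 : ℝ) * x ^ (1 / 2 : ℝ) = x := by
    rw [← Real.rpow_add hx0]; norm_num
  have h4 : (-(1 / 2) + 1 : ℝ) = 1 / 2 := by norm_num
  rw [h4] at h2
  calc _ ≤ 81 * C * x ^ (1 / 2 : ℝ) * ((1 + Real.log x) ^ 4)⁻¹ *
        (x ^ (1 / 2 : ℝ) / (1 / 2)) := by gcongr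
    _ = 81 * C * 2 * ((x ^ (1 / 2 : ℝ) * x ^ (1 / 2 : ℝ)) * ((1 + Real.log x) ^ 4)⁻¹) := by ring
    _ = _ := by rw [h3]

lemma exists_abs_integral_inv_log_sq_sub_le :
    ∃ C : ℝ, 0 < C ∧ ∀ x : ℝ, 2 ≤ x →
      |(∫ t in (2 : ℝ)..x, (Real.log t ^ 2)⁻¹) -
        (x / Real.log x ^ 2 + 2 * (x / Real.log x ^ 3))| ≤
        C * (x * ((1 + Real.log x) ^ 4)⁻¹) := by
  obtain ⟨C, hC, h⟩ := exists_integral_inv_log_pow_four_le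
  obtain ⟨D, hD, hs⟩ := exists_inv_one_add_log_pow_le 4 one_pos
  obtain ⟨B, hB⟩ : ∃ B : ℝ, B = 2 / Real.log 2 ^ 2 + 2 * (2 / Real.log 2 ^ 3) := ⟨_, rfl⟩
  have hl2 : 0 < Real.log 2 := Real.log_pos (by norm_num)
  have hB0 : 0 ≤ B := by rw [hB]; positivity
  refine ⟨6 * C + B * D, by positivity, fun x hx => ?_⟩
  have hftc := intervalIntegral.integral_eq_sub_of_hasDerivAt
    (a := 2) (b := x) (fun t ht => hasDerivAt_div_log_sq_add (t := t) (by
      rw [Set.uIcc_of_le hx] at ht; linarith [ht.1]))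
    ((intervalIntegrable_inv_log_pow 2 hx).sub ((intervalIntegrable_inv_log_pow 4 hx).const_mul 6))
  rw [intervalIntegral.integral_sub (intervalIntegrable_inv_log_pow 2 hx)
    ((intervalIntegrable_inv_log_pow 4 hx).const_mul 6), intervalIntegral.integral_const_mul,
    ← hB] at hftc
  have h1 := h x hx
  have h0 : 0 ≤ ∫ t in (2 : ℝ)..x, (Real.log t ^ 4)⁻¹ :=
    intervalIntegral.integral_nonneg hx fun t _ => by positivity
  have h2 := hs 1 x le_rfl (by linarith)
  rw [Real.log_one, add_zero, one_pow, inv_one, div_one, Real.rpow_one] at h2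
  have h3 : B ≤ B * (D * x * ((1 + Real.log x) ^ 4)⁻¹) := le_mul_of_one_le_right hB0 h2
  have h4 : 0 ≤ B * (D * x * ((1 + Real.log x) ^ 4)⁻¹) := hB0.trans h3
  have h5 : 0 ≤ C * (x * ((1 + Real.log x) ^ 4)⁻¹) := h0.trans h1
  rw [abs_le]
  constructor <;> linarith

/-- The summand `(p / q) ^ α` at `n = p * q` with primes `p < q`. -/
noncomputable def pairRatioWeight (α : ℝ) : ℕ → ℝ :=
  primePairWeight fun p q => ((p : ℝ) / q) ^ α

lemma primePairWeight_zero (f : ℕ → ℕ → ℝ) : primePairWeight f 0 = 0 :=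
  if_neg (by simp)

lemma primePairWeight_one (f : ℕ → ℕ → ℝ) : primePairWeight f 1 = 0 :=
  if_neg (by simp)

lemma pairRatioWeight_nonneg (α : ℝ) (n : ℕ) : 0 ≤ pairRatioWeight α n := by
  rcases primePairWeight_cases n with h | ⟨p, q, -, -, -, -, h⟩
  · exact (h _).ge
  · rw [pairRatioWeight, h]
    positivity

lemma pairRatioWeight_le_one {α : ℝ} (hα : 0 < α) (n : ℕ) : pairRatioWeight α n ≤ 1 := by
  rcases primePairWeight_cases n with h | ⟨p, q, -, -, hpq, -, h⟩
  · exact (h _).trans_le zero_le_one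
  · rw [pairRatioWeight, h]
    have : (p : ℝ) ≤ q := by exact_mod_cast hpq.le
    exact Real.rpow_le_one (by positivity) (div_le_one_of_le₀ this (by positivity)) hα.le

lemma sum_pairRatioWeight_le {α : ℝ} (hα : 0 < α) {t : ℝ} (ht : 0 ≤ t) :
    ∑ n ∈ Finset.Icc 0 ⌊t⌋₊, pairRatioWeight α n ≤ t := by
  rw [Finset.Icc_eq_cons_Ioc (Nat.zero_le _), Finset.sum_cons, pairRatioWeight,
    primePairWeight_zero, zero_add, ← pairRatioWeight]
  calc _ ≤ ∑ n ∈ Finset.Ioc 0 ⌊t⌋₊, (1 : ℝ) :=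
        Finset.sum_le_sum fun n _ => pairRatioWeight_le_one hα n
    _ = ⌊t⌋₊ := by simp
    _ ≤ t := Nat.floor_le ht

lemma exists_abs_pairRatioWeight_sub_le {α : ℝ} (hα : 0 < α) :
    ∃ C : ℝ, 0 < C ∧ ∀ n : ℕ,
      |pairRatioWeight α n - 4 * (pairLogWeight α n / Real.log n ^ 2)| ≤
        C * (pairRatioWeight (α / 2) n / Real.log n ^ 2) := by
  obtain ⟨C, hC, h⟩ := exists_one_add_log_pow_le 2 (half_pos hα)
  refine ⟨C, hC, fun n => ?_⟩
  unfold pairRatioWeight pairLogWeight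
  rcases primePairWeight_cases n with h0 | ⟨p, q, hp, hq, hpq, rfl, hw⟩
  · simp [h0]
  · rw [hw, hw, hw]
    have hp1 : (1 : ℝ) < p := by exact_mod_cast hp.one_lt
    have hpq' : (p : ℝ) < q := by exact_mod_cast hpq
    have hp0 : (0 : ℝ) < p := by linarith
    have hq0 : (0 : ℝ) < q := by linarith
    have hu : 0 < Real.log p := Real.log_pos hp1
    have hv : 0 < Real.log q := Real.log_pos (by linarith)
    have hr1 : 1 ≤ (q : ℝ) / p := (one_le_div hp0).mpr hpq'.le
    have hr := h _ hr1
    have hlr : 0 ≤ Real.log ((q : ℝ) / p) := Real.log_nonneg hr1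
    have hsq : (Real.log q - Real.log p) ^ 2 ≤ C * ((q : ℝ) / p) ^ (α / 2) := by
      rw [← Real.log_div hq0.ne' hp0.ne']
      refine le_trans ?_ hr
      gcongr
      linarith
    have hpow : ((p : ℝ) / q) ^ α * ((q : ℝ) / p) ^ (α / 2) = ((p : ℝ) / q) ^ (α / 2) := by
      rw [← inv_div (p : ℝ) q, Real.inv_rpow (by positivity), ← Real.rpow_neg (by positivity),
        ← Real.rpow_add (by positivity)]
      ring_nf
    have e : ((p : ℝ) / q) ^ α - 4 * (((p : ℝ) / q) ^ α * Real.log p * Real.log q /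
        (Real.log p + Real.log q) ^ 2) =
        ((p : ℝ) / q) ^ α * (Real.log q - Real.log p) ^ 2 / (Real.log p + Real.log q) ^ 2 := by
      field_simp
      ring
    rw [Nat.cast_mul, Real.log_mul hp0.ne' hq0.ne', e, abs_of_nonneg (by positivity), ← mul_div_assoc]
    refine div_le_div_of_nonneg_right ?_ (by positivity)
    calc _ ≤ ((p : ℝ) / q) ^ α * (C * ((q : ℝ) / p) ^ (α / 2)) := by gcongr
      _ = C * (((p : ℝ) / q) ^ α * ((q : ℝ) / p) ^ (α / 2)) := by ring
      _ = _ := by rw [hpow]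

lemma exists_abs_sum_pairRatioWeight_sub_le_sum {α : ℝ} (hα : 0 < α) :
    ∃ C : ℝ, 0 < C ∧ ∀ N : ℕ,
      |∑ n ∈ Finset.Icc 0 N, pairRatioWeight α n -
        4 * ∑ n ∈ Finset.Icc 0 N, pairLogWeight α n / Real.log n ^ 2| ≤
        C * ∑ n ∈ Finset.Icc 0 N, pairRatioWeight (α / 2) n / Real.log n ^ 2 := by
  obtain ⟨C, hC, h⟩ := exists_abs_pairRatioWeight_sub_le hα
  refine ⟨C, hC, fun N => ?_⟩
  rw [Finset.mul_sum, Finset.mul_sum, ← Finset.sum_sub_distrib]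
  exact (Finset.abs_sum_le_sum_abs _ _).trans (Finset.sum_le_sum fun n _ => h n)

lemma exists_sum_pairRatioWeight_le {α : ℝ} (hα : 0 < α) :
    ∃ K : ℝ, 0 ≤ K ∧ ∀ x : ℝ, 2 ≤ x →
      ∑ n ∈ Finset.Icc 0 ⌊x⌋₊, pairRatioWeight α n ≤ K * (x * ((1 + Real.log x) ^ 2)⁻¹) := by
  obtain ⟨C, hC, h⟩ := exists_abs_sum_pairRatioWeight_sub_le_sum hα
  obtain ⟨K, hK, hT⟩ := exists_abs_sum_pairLogWeight_sub_le hα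
  obtain ⟨A, hA, h₁⟩ := exists_abs_sum_div_log_pow_sub_le (c := pairRatioWeight (α / 2)) (κ := 0)
    (K := 1) (A := 0) (b := 0) (j := 2) (by norm_num) zero_le_one (primePairWeight_zero _)
    (primePairWeight_one _) (by
      intro t ht
      rw [abs_of_nonneg (by
        rw [zero_mul, sub_zero]
        exact Finset.sum_nonneg fun n _ => pairRatioWeight_nonneg _ n)]
      simpa using sum_pairRatioWeight_le (half_pos hα) (by linarith : 0 ≤ t))
  obtain ⟨B, hB, h₂⟩ := exists_abs_sum_div_log_pow_sub_le (c := pairLogWeight α) (κ := 0)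
    (K := K + 1 / (2 * α)) (A := 0) (b := 0) (j := 2) (by norm_num) (by positivity)
    (primePairWeight_zero _) (primePairWeight_one _) (by
      intro t ht
      have h1 := hT t (by linarith)
      have h2 : ((1 + Real.log t) ^ 2)⁻¹ ≤ 1 := by
        have := Real.log_nonneg (by linarith : 1 ≤ t)
        exact inv_le_one_of_one_le₀ (one_le_pow₀ (by linarith))
      have h3 : K * (t * ((1 + Real.log t) ^ 2)⁻¹) ≤ K * t := by
        gcongr
        exact mul_le_of_le_one_right (by linarith) h2
      have h4 : 0 ≤ 1 / (2 * α) * t := by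
        have : 0 ≤ t := by linarith
        positivity
      simp only [zero_mul, sub_zero, pow_zero, mul_one, inv_one]
      rw [abs_le] at h1 ⊢
      constructor <;> linarith)
  refine ⟨4 * B + C * A, by positivity, fun x hx => ?_⟩
  have e₁ := (abs_le.mp (h₁ x hx)).2
  have e₂ := (abs_le.mp (h₂ x hx)).2
  have e₃ := (abs_le.mp (h ⌊x⌋₊)).2
  simp only [zero_mul, sub_zero, zero_add] at e₁ e₂
  have e₄ := mul_le_mul_of_nonneg_left e₁ hC.le
  linarith

lemma exists_abs_sum_pairRatioWeight_sub_le {α : ℝ} (hα : 0 < α) :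
    ∃ K : ℝ, 0 ≤ K ∧ ∀ x : ℝ, 2 ≤ x →
      |∑ n ∈ Finset.Icc 0 ⌊x⌋₊, pairRatioWeight α n -
        ((2 / α) * (x / Real.log x ^ 2) + (4 / α) * (x / Real.log x ^ 3))| ≤
        K * (x * ((1 + Real.log x) ^ 4)⁻¹) := by
  obtain ⟨C, hC, h⟩ := exists_abs_sum_pairRatioWeight_sub_le_sum hα
  obtain ⟨K, hK, hT⟩ := exists_abs_sum_pairLogWeight_sub_le hα
  obtain ⟨M, hM, hR⟩ := exists_sum_pairRatioWeight_le (half_pos hα)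
  obtain ⟨L, hL, hLi⟩ := exists_abs_integral_inv_log_sq_sub_le
  obtain ⟨A, hA, h₁⟩ := exists_abs_sum_div_log_pow_sub_le (c := pairRatioWeight (α / 2)) (κ := 0)
    (K := M) (A := 0) (b := 2) (j := 2) (by norm_num) hM (primePairWeight_zero _)
    (primePairWeight_one _) (by
      intro t ht
      rw [abs_of_nonneg (by
        rw [zero_mul, sub_zero]
        exact Finset.sum_nonneg fun n _ => pairRatioWeight_nonneg _ n)]
      simpa using hR t ht)
  obtain ⟨B, hB, h₂⟩ := exists_abs_sum_div_log_pow_sub_le (c := pairLogWeight α)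
    (κ := 1 / (2 * α)) (K := K) (A := 0) (b := 2) (j := 2) (by norm_num) hK.le
    (primePairWeight_zero _) (primePairWeight_one _) (by
      intro t ht
      rw [pow_zero, mul_one]
      exact hT t (by linarith))
  refine ⟨C * A + 4 * B + 2 / α * L, by positivity, fun x hx => ?_⟩
  have e₁ := (abs_le.mp (h₁ x hx)).2
  have e₂ := h₂ x hx
  have e₃ := h ⌊x⌋₊
  have e₅ := hLi x hx
  simp only [zero_mul, sub_zero, show 2 + 2 = 4 from rfl] at e₁ e₂
  have e₄ := mul_le_mul_of_nonneg_left e₁ hC.le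
  have hα2 : 0 < 2 / α := by positivity
  have e₆ := mul_le_mul_of_nonneg_left e₅ hα2.le
  rw [← abs_of_pos hα2, ← abs_mul, abs_of_pos hα2] at e₆
  have e₇ : (2 / α) * ((∫ t in (2 : ℝ)..x, (Real.log t ^ 2)⁻¹) -
      (x / Real.log x ^ 2 + 2 * (x / Real.log x ^ 3))) =
      4 * (1 / (2 * α) * ∫ t in (2 : ℝ)..x, (Real.log t ^ 2)⁻¹) -
      ((2 / α) * (x / Real.log x ^ 2) + (4 / α) * (x / Real.log x ^ 3)) := by
    field_simp
    ring
  rw [e₇] at e₆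
  rw [abs_le] at e₂ e₃ e₆ ⊢
  constructor <;> linarith

open Filter Finset

/-- For `α > 0`, the sum over squarefree `n ≤ x` with exactly two prime factors satisfies
`Σ^{(2)}(x) = (2/α)·x/log²x + (4/α)·x/log³x + O(x/log⁴x)`. -/
theorem squarefree_two_prime_factors_ratio_sum
    (α : ℝ) (hα : 0 < α) :
    (fun x : ℝ =>
        (∑ n ∈ (Finset.Icc 2 ⌊x⌋₊).filter
            (fun n => Squarefree n ∧ n.primeFactors.card = 2),
          ((n.minFac : ℝ) / ((n.primeFactors.sup id : ℕ) : ℝ)) ^ α)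
        - ((2 / α) * (x / Real.log x ^ 2) + (4 / α) * (x / Real.log x ^ 3)))
      =O[atTop] (fun x : ℝ => x / Real.log x ^ 4) := by
  obtain ⟨K, hK, h⟩ := exists_abs_sum_pairRatioWeight_sub_le hα
  refine Asymptotics.IsBigO.of_bound K ?_
  filter_upwards [eventually_ge_atTop 2] with x hx
  have hx0 : 0 < x := by linarith
  have hl : 0 < Real.log x := Real.log_pos (by linarith)
  have e : ∑ n ∈ (Finset.Icc 2 ⌊x⌋₊).filter (fun n => Squarefree n ∧ n.primeFactors.card = 2),
      ((n.minFac : ℝ) / ((n.primeFactors.sup id : ℕ) : ℝ)) ^ α =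
      ∑ n ∈ Finset.Icc 0 ⌊x⌋₊, pairRatioWeight α n := by
    rw [Finset.sum_filter]
    refine Finset.sum_subset (Finset.Icc_subset_Icc_left (Nat.zero_le 2)) fun n hn hn' => ?_
    rw [Finset.mem_Icc] at hn hn'
    obtain rfl | rfl : n = 0 ∨ n = 1 := by omega
    · exact if_neg (by simp)
    · exact if_neg (by simp)
  rw [e, Real.norm_eq_abs, Real.norm_of_nonneg (by positivity)]
  refine (h x hx).trans ?_
  rw [div_eq_mul_inv]
  gcongr
  linarith
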